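/- Let c be continuous, ε>0, let the basic cell masses be strictly positive, and let the partition graph of 𝒥_A and 𝒥_B be connected. Let S_A (resp. S_B) denote the domain decomposition iteration map, which sends π ∈ Π(μ,ν) to the coupling obtained by replacing, for each composite cell J of 𝒥_A (resp. 𝒥_B), the restriction π⌊(X_J×Y) by the unique minimizer of ∫_{X_J×Y} c dσ + ε·KL(σ|μ_J⊗ν) over σ ∈ Π(μ_J, ν_J), where μ_J and ν_J are the marginals of π⌊(X_J×Y). Let (π^k)_{k≥0} ⊆ Π(μ,ν) be a sequence with π^0 = π_init, π^{3ℓ+1} = S_A(π^{3ℓ}), π^{3ℓ+2} = S_B(π^{3ℓ+1}) for all ℓ, and π^{3ℓ+3} obtained from π^{3ℓ+2} by a flow update with gluing edge candidates (in particular π^{3ℓ+3} ∈ Π(μ,ν) and ⟨c,π^{3ℓ+3}⟩ + ε·KL(π^{3ℓ+3}|μ⊗ν) ≤ ⟨c,π^{3ℓ+2}⟩ + ε·KL(π^{3ℓ+2}|μ⊗ν)). Then (π^k)_k converges weak* to the unique minimizer of min_{σ∈Π(μ,ν)} ⟨c,σ⟩ + ε·KL(σ|μ⊗ν). -/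

import Mathlib

open MeasureTheory Filter Topology
open scoped ENNReal

noncomputable section

/-- `π` is a coupling (transport plan) between `μ` and `ν`. -/
def IsCoupling {X Y : Type*} [MeasurableSpace X] [MeasurableSpace Y]
    (μ : Measure X) (ν : Measure Y) (π : Measure (X × Y)) : Prop :=
  π.map Prod.fst = μ ∧ π.map Prod.snd = ν

/-- `φ(s) = s·log s − s + 1`; note `Real.log 0 = 0`, so `phiKL 0 = 1` as required. -/
def phiKL (s : ℝ) : ℝ := s * Real.log s - s + 1

/-- Kullback–Leibler divergence `KL(ρ|σ) = ∫ φ(dρ/dσ) dσ` if `ρ ≪ σ`, and `+∞` otherwise. -/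
def KL {Z : Type*} [MeasurableSpace Z] (ρ σ : Measure Z) : ℝ≥0∞ :=
  letI := Classical.propDecidable (ρ ≪ σ)
  if ρ ≪ σ then ∫⁻ z, ENNReal.ofReal (phiKL ((ρ.rnDeriv σ) z).toReal) ∂σ else ⊤

/-- The entropic optimal transport objective `⟨c,π⟩ + ε·KL(π|μ⊗ν)`, valued in `EReal`. -/
def EOT {X Y : Type*} [MeasurableSpace X] [MeasurableSpace Y]
    (c : X × Y → ℝ) (ε : ℝ) (μ : Measure X) (ν : Measure Y)
    (π : Measure (X × Y)) : EReal :=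
  ((∫ p, c p ∂π : ℝ) : EReal) + (ε : EReal) * ((KL π (μ.prod ν) : ℝ≥0∞) : EReal)


/-- The family of gluing edge candidates: `π̂_{ii} = π_i/m_i` on the diagonal, and for `i ≠ j`
the gluing candidate `π̂_{ij}(A×B) = (1/m_i) ∫_{X_i} (γ_{ij})_x(A)·(π_i)_x(B) dμ_i(x)`,
formalized via `Measure.bind` over the disintegration kernels `γk i j` and `πk i`. -/
def gluingPihat {X Y : Type*} [MeasurableSpace X] [MeasurableSpace Y]
    {I : Type*} [DecidableEq I]
    (μ : Measure X) (π : Measure (X × Y)) (Xpart : I → Set X)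
    (γk : I → I → X → Measure X) (πk : I → X → Measure Y) (i j : I) : Measure (X × Y) :=
  if i = j then (μ (Xpart i))⁻¹ • π.restrict (Xpart i ×ˢ Set.univ)
  else (μ (Xpart i))⁻¹ • (μ.restrict (Xpart i)).bind (fun x => (γk i j x).prod (πk i x))

/-- `w` is a mass preserving flow on the graph `(I, N)` for the cell masses `m_i = μ(X_i)`. -/
def IsMassPreservingFlow {X : Type*} [MeasurableSpace X] {I : Type*} [Fintype I]
    (μ : Measure X) (Xpart : I → Set X) (N : Finset (I × I)) (w : I → I → ℝ) : Prop :=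
  (∀ i j, 0 ≤ w i j) ∧ (∀ i j, (i, j) ∉ N → w i j = 0) ∧
  (∀ i, ∑ j, w i j = (μ (Xpart i)).toReal) ∧ (∀ i, ∑ j, w j i = (μ (Xpart i)).toReal)

/-- `π'` is obtained from `π` by a flow update with gluing edge candidates: there is a
neighbourhood set `N`, disintegration kernels defining the gluing edge candidates, and a
minimizer `w` of the min-cost flow problem such that `π' = Σ_{(i,j)∈N} w_{ij}·π̂_{ij}`. -/
def IsGluingFlowUpdate {X Y : Type*} [MeasurableSpace X] [MeasurableSpace Y]
    {I : Type*} [Fintype I] [DecidableEq I]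
    (μ : Measure X) (c : X × Y → ℝ) (Xpart : I → Set X)
    (π π' : Measure (X × Y)) : Prop :=
  ∃ N : Finset (I × I), (∀ i, (i, i) ∈ N) ∧ (∀ i j, (i, j) ∈ N → (j, i) ∈ N) ∧
    ∃ (γk : I → I → X → Measure X) (πk : I → X → Measure Y),
      (∀ i j, Measurable (γk i j)) ∧ (∀ i j x, IsProbabilityMeasure (γk i j x)) ∧
      (∀ i, Measurable (πk i)) ∧ (∀ i x, IsProbabilityMeasure (πk i x)) ∧
      (∀ i, π.restrict (Xpart i ×ˢ Set.univ)
        = (μ.restrict (Xpart i)).bind (fun x => (Measure.dirac x).prod (πk i x))) ∧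
      (∀ i j, (i, j) ∈ N → i ≠ j →
        (((μ (Xpart i))⁻¹ • μ.restrict (Xpart i)).bind
            (fun x => (Measure.dirac x).prod (γk i j x))).map Prod.snd
          = (μ (Xpart j))⁻¹ • μ.restrict (Xpart j)) ∧
      ∃ w : I → I → ℝ, IsMassPreservingFlow μ Xpart N w ∧
        (∀ w' : I → I → ℝ, IsMassPreservingFlow μ Xpart N w' →
          ∑ e ∈ N, w e.1 e.2 * ((∫ p, c p ∂(gluingPihat μ π Xpart γk πk e.1 e.2)) -
              ∫ p, c p ∂(gluingPihat μ π Xpart γk πk e.1 e.1)) ≤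
            ∑ e ∈ N, w' e.1 e.2 * ((∫ p, c p ∂(gluingPihat μ π Xpart γk πk e.1 e.2)) -
              ∫ p, c p ∂(gluingPihat μ π Xpart γk πk e.1 e.1))) ∧
        π' = ∑ e ∈ N, ENNReal.ofReal (w e.1 e.2) • gluingPihat μ π Xpart γk πk e.1 e.2

/-- The restriction of `π'` to `S × Y` is the (unique) optimizer of the domain decomposition
cell problem `min ∫ c dσ + ε·KL(σ|μ_J⊗ν)` over `σ ∈ Π(μ_J, ν_J)`, where `μ_J`, `ν_J` are the
marginals of `π⌊(S×Y)`. -/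
def CellSolve {X Y : Type*} [MeasurableSpace X] [MeasurableSpace Y]
    (c : X × Y → ℝ) (ε : ℝ) (ν : Measure Y)
    (π π' : Measure (X × Y)) (S : Set X) : Prop :=
  IsCoupling ((π.restrict (S ×ˢ Set.univ)).map Prod.fst)
      ((π.restrict (S ×ˢ Set.univ)).map Prod.snd) (π'.restrict (S ×ˢ Set.univ)) ∧
  ∀ σ : Measure (X × Y),
    IsCoupling ((π.restrict (S ×ˢ Set.univ)).map Prod.fst)
      ((π.restrict (S ×ˢ Set.univ)).map Prod.snd) σ →
    EOT c ε ((π.restrict (S ×ˢ Set.univ)).map Prod.fst) ν (π'.restrict (S ×ˢ Set.univ))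
      ≤ EOT c ε ((π.restrict (S ×ˢ Set.univ)).map Prod.fst) ν σ

lemma phiKL_zero : phiKL 0 = 1 := by simp [phiKL]

lemma continuous_phiKL : Continuous phiKL :=
  (Real.continuous_mul_log.sub continuous_id).add continuous_const

lemma phiKL_nonneg {s : ℝ} (hs : 0 ≤ s) : 0 ≤ phiKL s := by
  rcases hs.eq_or_lt with rfl | hs
  · simp [phiKL]
  · have h := Real.one_sub_inv_le_log_of_pos hs
    have h2 := mul_le_mul_of_nonneg_left h hs.le
    rw [mul_sub, mul_inv_cancel₀ hs.ne'] at h2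
    unfold phiKL; linarith

lemma phiKL_le_sq {s : ℝ} (hs : 0 ≤ s) : phiKL s ≤ (s - 1) ^ 2 := by
  rcases hs.eq_or_lt with rfl | hs
  · simp [phiKL]
  · have h := mul_le_mul_of_nonneg_left (Real.log_le_sub_one_of_pos hs) hs.le
    unfold phiKL; nlinarith

lemma sq_sqrt_sub_one_le_phiKL {s : ℝ} (hs : 0 ≤ s) : (√s - 1) ^ 2 ≤ phiKL s := by
  rcases hs.eq_or_lt with rfl | hs
  · simp [phiKL]
  · have ht : 0 < √s := Real.sqrt_pos.2 hs
    have h := mul_le_mul_of_nonneg_left (Real.one_sub_inv_le_log_of_pos ht) hs.le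
    have hss : √s * √s = s := Real.mul_self_sqrt hs.le
    have h1 : s * (√s)⁻¹ = √s := by
      field_simp; nlinarith
    have hl : Real.log s = 2 * Real.log √s := by
      rw [Real.log_sqrt hs.le]; ring
    unfold phiKL; rw [hl]; nlinarith

lemma abs_sub_le_phiKL {p q η : ℝ} (hp : 0 ≤ p) (hq : 0 < q) (hη : 0 < η) :
    |p - q| ≤ q * phiKL (p / q) / η + η * (p + q) := by
  have h := mul_le_mul_of_nonneg_left (sq_sqrt_sub_one_le_phiKL (div_nonneg hp hq.le)) hq.le
  have hsq : q * (√(p / q) - 1) ^ 2 = (√p - √q) ^ 2 := by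
    rw [Real.sqrt_div hp]
    have h1 : 0 < √q := Real.sqrt_pos.2 hq
    have h2 : √q * √q = q := Real.mul_self_sqrt hq.le
    field_simp
    nlinarith
  rw [hsq] at h
  have e1 : √q * √q = q := Real.mul_self_sqrt hq.le
  have e2 : √p * √p = p := Real.mul_self_sqrt hp
  set a := √p
  set b := √q
  have h3 : |p - q| = |a - b| * (a + b) := by
    rw [← abs_of_nonneg (add_nonneg (Real.sqrt_nonneg p) (Real.sqrt_nonneg q)), ← abs_mul]
    congr 1; change p - q = (a - b) * (a + b); nlinarith
  have h4 : |a - b| * (a + b) ≤ (a - b) ^ 2 / η + η * (p + q) := by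
    have : |a - b| * (a + b) ≤ (|a - b| ^ 2) / η + η * ((a + b) ^ 2 / 4) := by
      have : 0 ≤ (|a - b| - η * (a + b) / 2) ^ 2 / η := by positivity
      have e : (|a - b| - η * (a + b) / 2) ^ 2 / η
        = |a - b| ^ 2 / η + η * ((a + b) ^ 2 / 4) - |a - b| * (a + b) := by
        field_simp; ring
      linarith
    rw [sq_abs] at this
    have h5 : (a + b) ^ 2 / 4 ≤ p + q := by nlinarith [sq_nonneg (a - b)]
    nlinarith
  rw [h3]
  refine h4.trans ?_
  gcongr

lemma mul_phiKL_div_le {p q M : ℝ} (hM : 0 < M) (hp : 0 ≤ p) (hpM : p ≤ M) (hqM : q ≤ M)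
    (hq : M⁻¹ ≤ q) : q * phiKL (p / q) ≤ 2 * M ^ 2 * |p - q| := by
  have hq0 : 0 < q := (inv_pos.2 hM).trans_le hq
  have h := mul_le_mul_of_nonneg_left (phiKL_le_sq (div_nonneg hp hq0.le)) hq0.le
  have e : q * (p / q - 1) ^ 2 = |p - q| * (|p - q| * q⁻¹) := by
    rw [← mul_assoc, abs_mul_abs_self]; field_simp
  rw [e] at h
  refine h.trans ?_
  rw [mul_comm (2 * M ^ 2)]
  refine mul_le_mul_of_nonneg_left ?_ (abs_nonneg _)
  have h1 : |p - q| ≤ 2 * M := by rw [abs_le]; constructor <;> linarith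
  have h2 : q⁻¹ ≤ M := inv_le_of_inv_le₀ hM hq
  calc |p - q| * q⁻¹ ≤ (2 * M) * M := by gcongr
    _ = 2 * M ^ 2 := by ring

section Energy

variable {Z : Type*} [MeasurableSpace Z]

/-- The energy `∫ c p + ε ∫ φ(p)` of a density `p` with respect to `ρ`. -/
def energy (c : Z → ℝ) (ε : ℝ) (ρ : Measure Z) (p : Z → ℝ) : ℝ :=
  ∫ z, c z * p z ∂ρ + ε * ∫ z, phiKL (p z) ∂ρ

/-- The relative entropy `∫ q φ(p/q)` of two densities with respect to `ρ`. -/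
def relEnt (ρ : Measure Z) (p q : Z → ℝ) : ℝ := ∫ z, q z * phiKL (p z / q z) ∂ρ

lemma energy_eq_relEnt {ρ : Measure Z} [IsFiniteMeasure ρ] {c : Z → ℝ} (hc : Measurable c)
    {M : ℝ} (hcM : ∀ z, |c z| ≤ M) {ε : ℝ} (hε : 0 < ε) {p g L : Z → ℝ}
    (hp : Integrable p ρ) (hφ : Integrable (fun z => phiKL (p z)) ρ)
    (hq : Integrable (fun z => g z * Real.exp (-c z / ε)) ρ)
    (hpL : Integrable (fun z => p z * L z) ρ)
    (hL : ∀ᵐ z ∂ρ, p z ≠ 0 → 0 < g z ∧ L z = Real.log (g z)) :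
    Integrable (fun z => g z * Real.exp (-c z / ε) *
      phiKL (p z / (g z * Real.exp (-c z / ε)))) ρ ∧
    energy c ε ρ p = ε * (relEnt ρ p (fun z => g z * Real.exp (-c z / ε))
      + ∫ z, p z * L z ∂ρ + ∫ z, (1 - g z * Real.exp (-c z / ε)) ∂ρ) := by
  have hcp : Integrable (fun z => c z * p z) ρ :=
    hp.bdd_mul hc.aestronglyMeasurable (ae_of_all _ hcM)
  have key : ∀ᵐ z ∂ρ, g z * Real.exp (-c z / ε) * phiKL (p z / (g z * Real.exp (-c z / ε)))
      = ε⁻¹ * (c z * p z) + phiKL (p z) - p z * L z - (1 - g z * Real.exp (-c z / ε)) := by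
    filter_upwards [hL] with z hz
    by_cases h0 : p z = 0
    · simp [h0, phiKL_zero]
    · obtain ⟨hg, hl⟩ := hz h0
      have hx := Real.exp_pos (-c z / ε)
      rw [hl]
      unfold phiKL
      rw [Real.log_div h0 (by positivity), Real.log_mul hg.ne' hx.ne', Real.log_exp]
      field_simp
      ring
  have hq1 : Integrable (fun z => 1 - g z * Real.exp (-c z / ε)) ρ :=
    (integrable_const 1).sub hq
  have hrhs : Integrable (fun z => ε⁻¹ * (c z * p z) + phiKL (p z) - p z * L z
      - (1 - g z * Real.exp (-c z / ε))) ρ :=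
    (((hcp.const_mul _).add hφ).sub hpL).sub hq1
  refine ⟨hrhs.congr (by filter_upwards [key] with z hz using hz.symm), ?_⟩
  have h1 : relEnt ρ p (fun z => g z * Real.exp (-c z / ε)) = ε⁻¹ * ∫ z, c z * p z ∂ρ
      + ∫ z, phiKL (p z) ∂ρ - ∫ z, p z * L z ∂ρ - ∫ z, (1 - g z * Real.exp (-c z / ε)) ∂ρ := by
    unfold relEnt
    rw [integral_congr_ae key, integral_sub _ hq1,
      integral_sub _ hpL, integral_add (hcp.const_mul _) hφ, integral_const_mul]
    · exact (hcp.const_mul _).add hφ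
    · exact ((hcp.const_mul _).add hφ).sub hpL
  rw [h1]
  unfold energy
  field_simp
  ring

lemma relEnt_self {ρ : Measure Z} {q : Z → ℝ} : relEnt ρ q q = 0 := by
  have : ∀ z, q z * phiKL (q z / q z) = 0 := by
    intro z
    by_cases h : q z = 0
    · simp [h]
    · simp [h, phiKL]
  simp [relEnt, this]

lemma relEnt_nonneg {ρ : Measure Z} {p q : Z → ℝ} (hp : ∀ z, 0 ≤ p z) (hq : ∀ z, 0 ≤ q z) :
    0 ≤ relEnt ρ p q :=
  integral_nonneg fun z => mul_nonneg (hq z) (phiKL_nonneg (div_nonneg (hp z) (hq z)))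

lemma integral_abs_sub_le {ρ : Measure Z} {p q : Z → ℝ} (hp : ∀ z, 0 ≤ p z) (hq : ∀ z, 0 ≤ q z)
    (hpi : Integrable p ρ) (hqi : Integrable q ρ) (hac : ∀ᵐ z ∂ρ, q z = 0 → p z = 0)
    (hint : Integrable (fun z => q z * phiKL (p z / q z)) ρ) :
    ∫ z, |p z - q z| ∂ρ ≤ (1 + ∫ z, p z ∂ρ + ∫ z, q z ∂ρ) * √(relEnt ρ p q) := by
  have hD := relEnt_nonneg (ρ := ρ) hp hq
  have hP : 0 ≤ ∫ z, p z ∂ρ := integral_nonneg hp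
  have hQ : 0 ≤ ∫ z, q z ∂ρ := integral_nonneg hq
  have hpq : Integrable (fun z => p z + q z) ρ := hpi.add hqi
  have hη : ∀ η : ℝ, 0 < η →
      ∫ z, |p z - q z| ∂ρ ≤ relEnt ρ p q / η + η * (∫ z, p z ∂ρ + ∫ z, q z ∂ρ) := by
    intro η hη
    have : ∫ z, |p z - q z| ∂ρ
        ≤ ∫ z, (q z * phiKL (p z / q z) / η + η * (p z + q z)) ∂ρ := by
      refine integral_mono_ae (hpi.sub hqi).abs
        ((hint.div_const _).add (hpq.const_mul _)) ?_
      filter_upwards [hac] with z hz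
      rcases (hq z).eq_or_lt with h | h
      · simp [← h, hz h.symm]
      · exact abs_sub_le_phiKL (hp z) h hη
    rwa [integral_add (hint.div_const _) (hpq.const_mul _), integral_div,
      integral_const_mul, integral_add hpi hqi] at this
  rcases hD.eq_or_lt with h | h
  · rw [← h, Real.sqrt_zero, mul_zero]
    refine le_of_forall_pos_le_add fun δ hδ => ?_
    have h2 := hη (δ / (1 + (∫ z, p z ∂ρ + ∫ z, q z ∂ρ))) (by positivity)
    rw [← h, zero_div, zero_add] at h2
    rw [zero_add]
    refine h2.trans ?_
    rw [div_mul_eq_mul_div, div_le_iff₀ (by positivity)]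
    nlinarith
  · have h2 := hη _ (Real.sqrt_pos.2 h)
    rw [Real.div_sqrt] at h2
    linarith

lemma ae_eq_of_relEnt_le_zero {ρ : Measure Z} {p q : Z → ℝ} (hp : ∀ z, 0 ≤ p z)
    (hq : ∀ z, 0 ≤ q z) (hpi : Integrable p ρ) (hqi : Integrable q ρ)
    (hac : ∀ᵐ z ∂ρ, q z = 0 → p z = 0)
    (hint : Integrable (fun z => q z * phiKL (p z / q z)) ρ) (h : relEnt ρ p q ≤ 0) :
    p =ᵐ[ρ] q := by
  have h1 := integral_abs_sub_le hp hq hpi hqi hac hint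
  rw [le_antisymm h (relEnt_nonneg hp hq), Real.sqrt_zero, mul_zero] at h1
  have h2 := (integral_eq_zero_iff_of_nonneg (fun z => abs_nonneg (p z - q z))
    (hpi.sub hqi).abs).1 (le_antisymm h1 (integral_nonneg fun z => abs_nonneg _))
  filter_upwards [h2] with z hz
  exact sub_eq_zero.1 (abs_eq_zero.1 hz)

end Energy

section Density

variable {Z : Type*} [MeasurableSpace Z]

/-- The measure with real-valued density `p` with respect to `ρ`. -/
def dens (ρ : Measure Z) (p : Z → ℝ) : Measure Z := ρ.withDensity fun z => ENNReal.ofReal (p z)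

lemma dens_congr {ρ : Measure Z} {p q : Z → ℝ} (h : p =ᵐ[ρ] q) : dens ρ p = dens ρ q :=
  withDensity_congr_ae (h.mono fun z hz => by simp only [hz])

lemma integrable_dens_iff {ρ : Measure Z} {p f : Z → ℝ} (hp : Measurable p) (h0 : ∀ z, 0 ≤ p z) :
    Integrable f (dens ρ p) ↔ Integrable (fun z => p z * f z) ρ := by
  rw [dens, integrable_withDensity_iff_integrable_smul' hp.ennreal_ofReal
    (ae_of_all _ fun z => ENNReal.ofReal_lt_top)]
  simp [ENNReal.toReal_ofReal, h0]

lemma integral_dens {ρ : Measure Z} {p : Z → ℝ} (hp : Measurable p) (h0 : ∀ z, 0 ≤ p z)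
    (f : Z → ℝ) : ∫ z, f z ∂(dens ρ p) = ∫ z, p z * f z ∂ρ := by
  rw [dens, integral_withDensity_eq_integral_toReal_smul hp.ennreal_ofReal
    (ae_of_all _ fun z => ENNReal.ofReal_lt_top)]
  simp [ENNReal.toReal_ofReal, h0]

lemma integrable_of_isFiniteMeasure_dens {ρ : Measure Z} {p : Z → ℝ} (hp : Measurable p)
    (h0 : ∀ z, 0 ≤ p z) [IsFiniteMeasure (dens ρ p)] : Integrable p ρ := by
  simpa using (integrable_dens_iff hp h0).1 (integrable_const (μ := dens ρ p) (1 : ℝ))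

lemma KL_dens {ρ : Measure Z} [SigmaFinite ρ] {p : Z → ℝ} (hp : Measurable p)
    (h0 : ∀ z, 0 ≤ p z) :
    KL (dens ρ p) ρ = ∫⁻ z, ENNReal.ofReal (phiKL (p z)) ∂ρ := by
  rw [KL, if_pos (show dens ρ p ≪ ρ from withDensity_absolutelyContinuous _ _)]
  refine lintegral_congr_ae ?_
  filter_upwards [Measure.rnDeriv_withDensity ρ hp.ennreal_ofReal] with z hz
  rw [dens, hz, ENNReal.toReal_ofReal (h0 z)]

variable {X Y : Type*} [MeasurableSpace X] [MeasurableSpace Y]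

lemma EOT_dens {α : Measure X} {ν : Measure Y} [IsFiniteMeasure α] [IsFiniteMeasure ν]
    {c : X × Y → ℝ} {ε : ℝ} {p : X × Y → ℝ} (hp : Measurable p) (h0 : ∀ z, 0 ≤ p z)
    (hφ : Integrable (fun z => phiKL (p z)) (α.prod ν)) :
    EOT c ε α ν (dens (α.prod ν) p) = (energy c ε (α.prod ν) p : ℝ) := by
  rw [EOT, KL_dens hp h0, ← ofReal_integral_eq_lintegral_ofReal hφ
    (ae_of_all _ fun z => phiKL_nonneg (h0 z)), integral_dens hp h0, EReal.coe_ennreal_ofReal,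
    max_eq_left (integral_nonneg fun z => phiKL_nonneg (h0 z)), ← EReal.coe_mul, ← EReal.coe_add,
    energy]
  simp_rw [mul_comm (p _)]

lemma exists_dens_of_EOT_ne_top {α : Measure X} {ν : Measure Y} [IsFiniteMeasure α]
    [IsFiniteMeasure ν] {c : X × Y → ℝ} {ε : ℝ} (hε : 0 < ε) {π : Measure (X × Y)}
    [IsFiniteMeasure π] (h : EOT c ε α ν π ≠ ⊤) :
    ∃ p : X × Y → ℝ, Measurable p ∧ (∀ z, 0 ≤ p z) ∧ Integrable p (α.prod ν) ∧
      Integrable (fun z => phiKL (p z)) (α.prod ν) ∧ π = dens (α.prod ν) p := by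
  have hK : KL π (α.prod ν) ≠ ⊤ := by
    intro hK
    apply h
    rw [EOT, hK, EReal.coe_ennreal_top, EReal.coe_mul_top_of_pos hε, EReal.coe_add_top]
  have hac : π ≪ α.prod ν := by
    by_contra hac
    exact hK (by rw [KL, if_neg hac])
  set p : X × Y → ℝ := fun z => (π.rnDeriv (α.prod ν) z).toReal with hpdef
  have hp : Measurable p := (Measure.measurable_rnDeriv _ _).ennreal_toReal
  have h0 : ∀ z, 0 ≤ p z := fun z => ENNReal.toReal_nonneg
  have hπ : π = dens (α.prod ν) p := by
    conv_lhs => rw [← Measure.withDensity_rnDeriv_eq _ _ hac]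
    refine withDensity_congr_ae ?_
    filter_upwards [Measure.rnDeriv_ne_top π (α.prod ν)] with z hz
    rw [ENNReal.ofReal_toReal hz]
  refine ⟨p, hp, h0, Measure.integrable_toReal_rnDeriv, ?_, hπ⟩
  refine ⟨(continuous_phiKL.measurable.comp hp).aestronglyMeasurable, ?_⟩
  rw [hasFiniteIntegral_iff_ofReal (ae_of_all _ fun z => phiKL_nonneg (h0 z)), ← KL_dens hp h0,
    ← hπ]
  exact hK.lt_top

end Density

section Schrodinger

variable {X Y : Type*} [MeasurableSpace X] [MeasurableSpace Y]

/-- One Sinkhorn half step `y ↦ 1 / ∫ k(x,y) u(x) dα(x)`. -/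
def sinkhornStep (k : X → Y → ℝ) (α : Measure X) (u : X → ℝ) (y : Y) : ℝ :=
  (∫ x, k x y * u x ∂α)⁻¹

lemma measurable_sinkhornStep {k : X → Y → ℝ} (hk : Measurable (Function.uncurry k))
    {α : Measure X} [SFinite α] {u : X → ℝ} (hu : Measurable u) :
    Measurable (sinkhornStep k α u) := by
  have h : Measurable (fun p : X × Y => k p.1 p.2 * u p.1) :=
    (show Measurable fun p : X × Y => k p.1 p.2 from hk).mul (hu.comp measurable_fst)
  exact (h.stronglyMeasurable.integral_prod_left' (μ := α)).measurable.inv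

variable {k : X → Y → ℝ} {κ : ℝ} {α : Measure X}

lemma integrable_kernel_mul [IsFiniteMeasure α] (hk : Measurable (Function.uncurry k))
    (hκ : 0 < κ) (hk1 : ∀ x y, κ ≤ k x y) (hk2 : ∀ x y, k x y ≤ κ⁻¹) {u : X → ℝ}
    (hu : Integrable u α) (y : Y) : Integrable (fun x => k x y * u x) α :=
  hu.bdd_mul (c := κ⁻¹) (hk.comp measurable_prodMk_right).aestronglyMeasurable
    (ae_of_all _ fun x => by
      rw [Real.norm_eq_abs, abs_of_pos (hκ.trans_le (hk1 x y))]; exact hk2 x y)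

lemma integral_kernel_mul_mem [IsFiniteMeasure α] (hk : Measurable (Function.uncurry k))
    (hκ : 0 < κ) (hk1 : ∀ x y, κ ≤ k x y) (hk2 : ∀ x y, k x y ≤ κ⁻¹) {u : X → ℝ}
    (hu : Integrable u α) (hu0 : ∀ x, 0 ≤ u x) (y : Y) :
    κ * ∫ x, u x ∂α ≤ ∫ x, k x y * u x ∂α ∧ ∫ x, k x y * u x ∂α ≤ κ⁻¹ * ∫ x, u x ∂α := by
  have hi := integrable_kernel_mul hk hκ hk1 hk2 hu y
  rw [← integral_const_mul, ← integral_const_mul]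
  exact ⟨integral_mono (hu.const_mul _) hi fun x => mul_le_mul_of_nonneg_right (hk1 x y) (hu0 x),
    integral_mono hi (hu.const_mul _) fun x => mul_le_mul_of_nonneg_right (hk2 x y) (hu0 x)⟩

lemma integrable_of_bounds [IsFiniteMeasure α] {u : X → ℝ} {l L : ℝ} (hu : Measurable u)
    (hl : ∀ x, l ≤ u x) (hL : ∀ x, u x ≤ L) : Integrable u α :=
  Integrable.of_bound hu.aestronglyMeasurable (max |l| |L|)
    (ae_of_all _ fun x => abs_le_max_abs_abs (hl x) (hL x))

lemma integral_mem_of_bounds [IsFiniteMeasure α] {u : X → ℝ} {l L : ℝ} (hu : Measurable u)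
    (hl : ∀ x, l ≤ u x) (hL : ∀ x, u x ≤ L) :
    α.real Set.univ * l ≤ ∫ x, u x ∂α ∧ ∫ x, u x ∂α ≤ α.real Set.univ * L := by
  have hi : Integrable u α := integrable_of_bounds hu hl hL
  have h1 := integral_mono (integrable_const l) hi hl
  have h2 := integral_mono hi (integrable_const L) hL
  simp only [integral_const, smul_eq_mul] at h1 h2
  exact ⟨h1, h2⟩

lemma sinkhornStep_bounds [IsFiniteMeasure α] (hα : 0 < α.real Set.univ)
    (hk : Measurable (Function.uncurry k))
    (hκ : 0 < κ) (hk1 : ∀ x y, κ ≤ k x y) (hk2 : ∀ x y, k x y ≤ κ⁻¹) {u : X → ℝ} {l L : ℝ}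
    (hu : Measurable u) (hl0 : 0 < l) (hl : ∀ x, l ≤ u x) (hL : ∀ x, u x ≤ L) (y : Y) :
    0 < ∫ x, k x y * u x ∂α ∧ 0 < (κ⁻¹ * (α.real Set.univ * L))⁻¹ ∧
    (κ⁻¹ * (α.real Set.univ * L))⁻¹ ≤ sinkhornStep k α u y ∧
    sinkhornStep k α u y ≤ (κ * (α.real Set.univ * l))⁻¹ := by
  obtain ⟨h1, h2⟩ := integral_mem_of_bounds (α := α) hu hl hL
  obtain ⟨h3, h4⟩ := integral_kernel_mul_mem hk hκ hk1 hk2 (integrable_of_bounds (α := α) hu hl hL)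
    (fun x => hl0.le.trans (hl x)) y
  have h5 : κ * (α.real Set.univ * l) ≤ ∫ x, k x y * u x ∂α :=
    (mul_le_mul_of_nonneg_left h1 hκ.le).trans h3
  have h6 : ∫ x, k x y * u x ∂α ≤ κ⁻¹ * (α.real Set.univ * L) :=
    h4.trans (mul_le_mul_of_nonneg_left h2 (inv_pos.2 hκ).le)
  have h7 : 0 < κ * (α.real Set.univ * l) := by positivity
  have h8 := h7.trans_le h5
  exact ⟨h8, inv_pos.2 (h8.trans_le h6), inv_anti₀ h8 h6, inv_anti₀ h7 h5⟩

lemma sinkhornStep_contraction [IsFiniteMeasure α] (hα : 0 < α.real Set.univ)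
    (hk : Measurable (Function.uncurry k))
    (hκ : 0 < κ) (hκ1 : κ ≤ 1) (hk1 : ∀ x y, κ ≤ k x y) (hk2 : ∀ x y, k x y ≤ κ⁻¹)
    {u u' : X → ℝ} {l L : ℝ}
    (hu : Measurable u) (hl0 : 0 < l) (hl : ∀ x, l ≤ u x) (hL : ∀ x, u x ≤ L)
    (hu' : Measurable u') {a b : ℝ} (ha0 : 0 < a)
    (ha : ∀ x, a * u x ≤ u' x) (hb : ∀ x, u' x ≤ b * u x) (hab : a ≤ b) :
    ∃ a' b', a ≤ a' ∧ a' ≤ b' ∧ b' ≤ b ∧ b' - a' = (1 - κ ^ 2) * (b - a) ∧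
      ∀ y, b'⁻¹ * sinkhornStep k α u y ≤ sinkhornStep k α u' y ∧
        sinkhornStep k α u' y ≤ a'⁻¹ * sinkhornStep k α u y := by
  have hb0 : 0 < b := ha0.trans_le hab
  have hui : Integrable u α := integrable_of_bounds hu hl hL
  have hu0 : ∀ x, 0 < u x := fun x => hl0.trans_le (hl x)
  have hl' : ∀ x, a * l ≤ u' x := fun x => (mul_le_mul_of_nonneg_left (hl x) ha0.le).trans (ha x)
  have hL' : ∀ x, u' x ≤ b * L := fun x => (hb x).trans (mul_le_mul_of_nonneg_left (hL x) hb0.le)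
  have hui' : Integrable u' α := integrable_of_bounds hu' hl' hL'
  have hU : 0 < ∫ x, u x ∂α :=
    (mul_pos hα hl0).trans_le (integral_mem_of_bounds hu hl hL).1
  set m := (∫ x, u' x ∂α) / ∫ x, u x ∂α with hm
  have hmU : m * ∫ x, u x ∂α = ∫ x, u' x ∂α := div_mul_cancel₀ _ hU.ne'
  have h1 := integral_mono (hui.const_mul a) hui' ha
  have h2 := integral_mono hui' (hui.const_mul b) hb
  rw [integral_const_mul] at h1 h2
  have ham : a ≤ m := (le_div_iff₀ hU).2 h1
  have hmb : m ≤ b := (div_le_iff₀ hU).2 h2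
  have hκ2 : κ ^ 2 ≤ 1 := pow_le_one₀ hκ.le hκ1
  have hκ20 : 0 < κ ^ 2 := by positivity
  have ha'a : a ≤ κ ^ 2 * m + (1 - κ ^ 2) * a := by nlinarith
  have hb'b : κ ^ 2 * m + (1 - κ ^ 2) * b ≤ b := by nlinarith
  have hab' : κ ^ 2 * m + (1 - κ ^ 2) * a ≤ κ ^ 2 * m + (1 - κ ^ 2) * b := by nlinarith
  refine ⟨κ ^ 2 * m + (1 - κ ^ 2) * a, κ ^ 2 * m + (1 - κ ^ 2) * b, ha'a, hab', hb'b, by ring,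
    fun y => ?_⟩
  set a' := κ ^ 2 * m + (1 - κ ^ 2) * a
  set b' := κ ^ 2 * m + (1 - κ ^ 2) * b
  have ha'0 : 0 < a' := ha0.trans_le ha'a
  have hb'0 : 0 < b' := ha'0.trans_le hab'
  have hiu := integrable_kernel_mul hk hκ hk1 hk2 hui y
  have hiu' := integrable_kernel_mul hk hκ hk1 hk2 hui' y
  have hpos : 0 < ∫ x, k x y * u x ∂α := (sinkhornStep_bounds hα hk hκ hk1 hk2 hu hl0 hl hL y).1
  have hpos' : 0 < ∫ x, k x y * u' x ∂α :=
    (sinkhornStep_bounds hα hk hκ hk1 hk2 hu' (mul_pos ha0 hl0) hl' hL' y).1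
  have hU2 : κ * ∫ x, k x y * u x ∂α ≤ ∫ x, u x ∂α := by
    have := mul_le_mul_of_nonneg_left (integral_kernel_mul_mem hk hκ hk1 hk2 hui
      (fun x => (hu0 x).le) y).2 hκ.le
    rwa [← mul_assoc, mul_inv_cancel₀ hκ.ne', one_mul] at this
  have lower : a' * ∫ x, k x y * u x ∂α ≤ ∫ x, k x y * u' x ∂α := by
    have h := (integral_kernel_mul_mem hk hκ hk1 hk2 (hui'.sub (hui.const_mul a))
      (fun x => sub_nonneg.2 (ha x)) y).1
    have e1 : ∫ x, (u' - fun x => a * u x) x ∂α = (m - a) * ∫ x, u x ∂α := by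
      simp only [Pi.sub_apply]
      rw [integral_sub hui' (hui.const_mul a), integral_const_mul, ← hmU]; ring
    have e2 : ∫ x, k x y * (u' - fun x => a * u x) x ∂α
        = ∫ x, k x y * u' x ∂α - a * ∫ x, k x y * u x ∂α := by
      rw [← integral_const_mul, ← integral_sub hiu' (hiu.const_mul a)]
      congr 1; ext x; simp only [Pi.sub_apply]; ring
    rw [e1, e2] at h
    have h3 := mul_le_mul_of_nonneg_left hU2 (mul_nonneg hκ.le (sub_nonneg.2 ham))
    have e3 : a' = κ * (m - a) * κ + a := by simp only [a']; ring
    rw [e3]; nlinarith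
  have upper : ∫ x, k x y * u' x ∂α ≤ b' * ∫ x, k x y * u x ∂α := by
    have h := (integral_kernel_mul_mem hk hκ hk1 hk2 ((hui.const_mul b).sub hui')
      (fun x => sub_nonneg.2 (hb x)) y).1
    have e1 : ∫ x, ((fun x => b * u x) - u') x ∂α = (b - m) * ∫ x, u x ∂α := by
      simp only [Pi.sub_apply]
      rw [integral_sub (hui.const_mul b) hui', integral_const_mul, ← hmU]; ring
    have e2 : ∫ x, k x y * ((fun x => b * u x) - u') x ∂α
        = b * ∫ x, k x y * u x ∂α - ∫ x, k x y * u' x ∂α := by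
      rw [← integral_const_mul, ← integral_sub (hiu.const_mul b) hiu']
      congr 1; ext x; simp only [Pi.sub_apply]; ring
    rw [e1, e2] at h
    have h3 := mul_le_mul_of_nonneg_left hU2 (mul_nonneg hκ.le (sub_nonneg.2 hmb))
    have e3 : b' = b - κ * (b - m) * κ := by simp only [b']; ring
    rw [e3]; nlinarith
  unfold sinkhornStep
  rw [← mul_inv, ← mul_inv]
  exact ⟨inv_anti₀ hpos' upper, inv_anti₀ (mul_pos ha'0 hpos) lower⟩

lemma tendsto_sinkhornStep [IsFiniteMeasure α] (hα : 0 < α.real Set.univ)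
    (hk : Measurable (Function.uncurry k))
    (hκ : 0 < κ) (hk1 : ∀ x y, κ ≤ k x y) (hk2 : ∀ x y, k x y ≤ κ⁻¹)
    {u : ℕ → X → ℝ} {w : X → ℝ} {l L : ℝ} (hu : ∀ n, Measurable (u n)) (hl0 : 0 < l)
    (hl : ∀ n x, l ≤ u n x) (hL : ∀ n x, u n x ≤ L)
    (hlim : ∀ x, Tendsto (fun n => u n x) atTop (𝓝 (w x))) (y : Y) :
    Tendsto (fun n => sinkhornStep k α (u n) y) atTop (𝓝 (sinkhornStep k α w y)) := by
  have hw : Measurable w := measurable_of_tendsto_metrizable hu (tendsto_pi_nhds.2 hlim)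
  have hwl : ∀ x, l ≤ w x := fun x => ge_of_tendsto' (hlim x) fun n => hl n x
  have hwL : ∀ x, w x ≤ L := fun x => le_of_tendsto' (hlim x) fun n => hL n x
  refine Tendsto.inv₀ ?_ (sinkhornStep_bounds hα hk hκ hk1 hk2 hw hl0 hwl hwL y).1.ne'
  refine tendsto_integral_of_dominated_convergence (fun _ => κ⁻¹ * L) (fun n => ?_)
    (integrable_const _) (fun n => ae_of_all _ fun x => ?_)
    (ae_of_all _ fun x => (hlim x).const_mul _)
  · exact ((hk.comp measurable_prodMk_right).mul (hu n)).aestronglyMeasurable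
  · have h1 := hκ.trans_le (hk1 x y)
    have h2 := hl0.trans_le (hl n x)
    rw [Real.norm_eq_abs, abs_of_pos (mul_pos h1 h2)]
    exact mul_le_mul (hk2 x y) (hL n x) h2.le (inv_pos.2 hκ).le

end Schrodinger

section SchrodingerSystem

variable {X Y : Type*} [MeasurableSpace X] [MeasurableSpace Y]
  {k : X → Y → ℝ} {κ : ℝ} {α : Measure X} {β : Measure Y}

lemma integral_div_sinkhornStep [IsFiniteMeasure α] [IsFiniteMeasure β]
    (hα : 0 < α.real Set.univ)
    (hk : Measurable (Function.uncurry k))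
    (hκ : 0 < κ) (hk1 : ∀ x y, κ ≤ k x y) (hk2 : ∀ x y, k x y ≤ κ⁻¹)
    {u : X → ℝ} {l L : ℝ}
    (hu : Measurable u) (hl0 : 0 < l) (hl : ∀ x, l ≤ u x) (hL : ∀ x, u x ≤ L) :
    ∫ x, u x / sinkhornStep (fun y x => k x y) β (sinkhornStep k α u) x ∂α = β.real Set.univ := by
  have hv := measurable_sinkhornStep hk (α := α) hu
  have hb := sinkhornStep_bounds hα hk hκ hk1 hk2 hu hl0 hl hL
  set v := sinkhornStep k α u with hvdef
  have hmeas : Measurable (Function.uncurry fun x y => u x * (k x y * v y)) :=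
    (hu.comp measurable_fst).mul
      ((show Measurable fun p : X × Y => k p.1 p.2 from hk).mul (hv.comp measurable_snd))
  have hint : Integrable (Function.uncurry fun x y => u x * (k x y * v y)) (α.prod β) := by
    refine Integrable.of_bound hmeas.aestronglyMeasurable
      (L * (κ⁻¹ * (κ * (α.real Set.univ * l))⁻¹)) (ae_of_all _ fun p => ?_)
    have h1 := hκ.trans_le (hk1 p.1 p.2)
    have h2 := hl0.trans_le (hl p.1)
    obtain ⟨-, h4, h5, h6⟩ := hb p.2
    have h7 := h4.trans_le h5
    have h8 := hk2 p.1 p.2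
    have h9 := hL p.1
    have h10 : 0 < κ⁻¹ := inv_pos.2 hκ
    simp only [Function.uncurry, Real.norm_eq_abs]
    rw [abs_of_pos (by positivity)]
    have h11 : 0 < L := h2.trans_le h9
    gcongr
  calc ∫ x, u x / sinkhornStep (fun y x => k x y) β v x ∂α
      = ∫ x, ∫ y, u x * (k x y * v y) ∂β ∂α := by
        congr 1; ext x
        rw [integral_const_mul, sinkhornStep, div_inv_eq_mul]
    _ = ∫ y, ∫ x, u x * (k x y * v y) ∂α ∂β := integral_integral_swap hint
    _ = ∫ y, (1 : ℝ) ∂β := by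
        congr 1; ext y
        rw [show (fun x => u x * (k x y * v y)) = fun x => v y * (k x y * u x) by
          ext x; ring, integral_const_mul, hvdef, sinkhornStep, inv_mul_cancel₀ (hb y).1.ne']
    _ = β.real Set.univ := by simp

lemma exists_schrodinger_potentials [IsFiniteMeasure α] [IsFiniteMeasure β]
    (hα : 0 < α.real Set.univ) (hαβ : α.real Set.univ = β.real Set.univ)
    (hk : Measurable (Function.uncurry k))
    (hκ : 0 < κ) (hκ1 : κ ≤ 1) (hk1 : ∀ x y, κ ≤ k x y) (hk2 : ∀ x y, k x y ≤ κ⁻¹) :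
    ∃ u : X → ℝ, Measurable u ∧ (∃ l L : ℝ, 0 < l ∧ ∀ x, l ≤ u x ∧ u x ≤ L) ∧
      sinkhornStep (fun y x => k x y) β (sinkhornStep k α u) = u := by
  have hβ : 0 < β.real Set.univ := hαβ ▸ hα
  have hk' : Measurable (Function.uncurry fun y x => k x y) := hk.comp measurable_swap
  set T : (X → ℝ) → X → ℝ := fun u => sinkhornStep (fun y x => k x y) β (sinkhornStep k α u)
    with hT
  set u : ℕ → X → ℝ := fun n => T^[n] (fun _ => 1) with hudef
  have hsucc : ∀ n, u (n + 1) = T (u n) := fun n => Function.iterate_succ_apply' _ _ _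
  have hTmeas : ∀ w, Measurable w → Measurable (T w) := fun w hw =>
    measurable_sinkhornStep hk' (measurable_sinkhornStep hk hw)
  have hTbd : ∀ w, Measurable w → (∃ l L : ℝ, 0 < l ∧ ∀ x, l ≤ w x ∧ w x ≤ L) →
      ∃ l L : ℝ, 0 < l ∧ ∀ x, l ≤ T w x ∧ T w x ≤ L := by
    rintro w hw ⟨l, L, hl0, hlL⟩
    rcases isEmpty_or_nonempty X with hX | ⟨⟨x₀⟩⟩
    · exact ⟨1, 1, one_pos, fun x => hX.elim x⟩
    rcases isEmpty_or_nonempty Y with hY | ⟨⟨y₀⟩⟩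
    · simp [Measure.eq_zero_of_isEmpty] at hβ
    have hb := sinkhornStep_bounds hα hk hκ hk1 hk2 hw hl0 (fun x => (hlL x).1) (fun x => (hlL x).2)
    have hb2 := sinkhornStep_bounds hβ hk' hκ (fun y x => hk1 x y) (fun y x => hk2 x y)
      (measurable_sinkhornStep hk hw) (hb y₀).2.1 (fun y => (hb y).2.2.1) (fun y => (hb y).2.2.2)
    exact ⟨_, _, (hb2 x₀).2.1, fun x => (hb2 x).2.2⟩
  have hmeas : ∀ n, Measurable (u n) := by
    intro n
    induction n with
    | zero => exact measurable_const
    | succ n ih => rw [hsucc]; exact hTmeas _ ih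
  have hbd : ∀ n, ∃ l L : ℝ, 0 < l ∧ ∀ x, l ≤ u n x ∧ u n x ≤ L := by
    intro n
    induction n with
    | zero => exact ⟨1, 1, one_pos, fun x => ⟨le_rfl, le_rfl⟩⟩
    | succ n ih => rw [hsucc]; exact hTbd _ (hmeas n) ih
  set r : ℝ := 1 - κ ^ 2 with hr
  have hr0 : 0 ≤ r := sub_nonneg.2 (pow_le_one₀ hκ.le hκ1)
  have hr1 : r < 1 := by have : 0 < κ ^ 2 := by positivity
                         linarith
  obtain ⟨l₁, L₁, hl₁, hlL₁⟩ := hbd 1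
  set a₀ := min l₁ 1
  set b₀ := max L₁ 1
  have ha₀ : 0 < a₀ := lt_min hl₁ one_pos
  have hab₀ : a₀ ≤ b₀ := (min_le_right _ _).trans (le_max_right _ _)
  have hratio : ∀ n, ∃ a b : ℝ, a₀ ≤ a ∧ a ≤ b ∧ b ≤ b₀ ∧ b - a = r ^ n * (b₀ - a₀) ∧
      ∀ x, a * u n x ≤ u (n + 1) x ∧ u (n + 1) x ≤ b * u n x := by
    intro n
    induction n with
    | zero =>
      refine ⟨a₀, b₀, le_rfl, hab₀, le_rfl, by simp, fun x => ?_⟩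
      change a₀ * 1 ≤ u 1 x ∧ u 1 x ≤ b₀ * 1
      rw [mul_one, mul_one]
      exact ⟨(min_le_left _ _).trans (hlL₁ x).1, (hlL₁ x).2.trans (le_max_left _ _)⟩
    | succ n ih =>
      obtain ⟨a, b, ha, hab, hb, hd, hx⟩ := ih
      have ha0 : 0 < a := ha₀.trans_le ha
      obtain ⟨l, L, hl0, hlL⟩ := hbd n
      obtain ⟨a', b', haa', hab', hbb', hd', hy⟩ := sinkhornStep_contraction hα hk hκ hκ1 hk1 hk2
        (hmeas n) hl0 (fun x => (hlL x).1) (fun x => (hlL x).2) (hmeas (n + 1)) ha0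
        (fun x => (hx x).1) (fun x => (hx x).2) hab
      have ha'0 : 0 < a' := ha0.trans_le haa'
      refine ⟨a', b', ha.trans haa', hab', hbb'.trans hb, ?_, fun x => ?_⟩
      · rw [hd', hd]; ring
      · have : Nonempty X := ⟨x⟩
        rcases isEmpty_or_nonempty Y with hY | ⟨⟨y₀⟩⟩
        · simp [Measure.eq_zero_of_isEmpty] at hβ
        have hsb := sinkhornStep_bounds hα hk hκ hk1 hk2 (hmeas n) hl0 (fun x => (hlL x).1)
          (fun x => (hlL x).2)
        obtain ⟨a'', b'', h1, h2, h3, -, h5⟩ := sinkhornStep_contraction hβ hk' hκ hκ1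
          (fun y x => hk1 x y) (fun y x => hk2 x y) (measurable_sinkhornStep hk (hmeas n))
          (hsb y₀).2.1 (fun y => (hsb y).2.2.1) (fun y => (hsb y).2.2.2)
          (measurable_sinkhornStep hk (hmeas (n + 1))) (inv_pos.2 (ha'0.trans_le hab'))
          (fun y => (hy y).1) (fun y => (hy y).2) (inv_anti₀ ha'0 hab')
        have ha''0 : 0 < a'' := (inv_pos.2 (ha'0.trans_le hab')).trans_le h1
        obtain ⟨h6, h7⟩ := h5 x
        rw [hsucc (n + 1)]
        have hnn : 0 ≤ u (n + 1) x := by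
          obtain ⟨l', L', hl0', hlL'⟩ := hbd (n + 1)
          exact hl0'.le.trans (hlL' x).1
        have e : sinkhornStep (fun y x => k x y) β (sinkhornStep k α (u n)) x = u (n + 1) x := by
          rw [hsucc n]
        rw [e] at h6 h7
        refine ⟨le_trans ?_ h6, h7.trans ?_⟩
        · refine mul_le_mul_of_nonneg_right ?_ hnn
          rw [← inv_inv a']; exact inv_anti₀ (ha''0.trans_le h2) h3
        · refine mul_le_mul_of_nonneg_right ?_ hnn
          rw [← inv_inv b']; exact inv_anti₀ (inv_pos.2 (ha'0.trans_le hab')) h1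
  set C := (b₀ - a₀) / a₀ with hC
  have hC0 : 0 ≤ C := div_nonneg (sub_nonneg.2 hab₀) ha₀.le
  have ha₀1 : a₀ ≤ 1 := min_le_right _ _
  have hpos : ∀ n x, 0 < u n x := fun n x => by
    obtain ⟨l, L, hl0, hlL⟩ := hbd n
    exact hl0.trans_le (hlL x).1
  have hlog : ∀ x n, dist (Real.log (u n x)) (Real.log (u (n + 1) x)) ≤ C * r ^ n := by
    intro x n
    obtain ⟨a, b, ha, hab, hb, hd, hx⟩ := hratio n
    have ha0 : 0 < a := ha₀.trans_le ha
    obtain ⟨l, L, hl0, hlL⟩ := hbd n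
    obtain ⟨l', L', hl0', hlL'⟩ := hbd (n + 1)
    have hmass : ∫ x, u n x / u (n + 1) x ∂α = α.real Set.univ := by
      rw [hαβ, hsucc n]
      exact integral_div_sinkhornStep hα hk hκ hk1 hk2 (hmeas n) hl0 (fun x => (hlL x).1)
        (fun x => (hlL x).2)
    have hq := integral_mem_of_bounds (α := α) (l := b⁻¹) (L := a⁻¹)
      ((hmeas n).div (hmeas (n + 1))) (fun x => by
        rw [Pi.div_apply, le_div_iff₀ (hpos _ x), inv_mul_le_iff₀ (ha0.trans_le hab)]
        exact (hx x).2) (fun x => by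
        rw [Pi.div_apply, div_le_iff₀ (hpos _ x), inv_mul_eq_div, le_div_iff₀ ha0, mul_comm]
        exact (hx x).1)
    simp only [Pi.div_apply] at hq
    rw [hmass] at hq
    have ha1 : a ≤ 1 := by
      have h1 : (1 : ℝ) ≤ a⁻¹ := by nlinarith [hq.2]
      exact (one_le_inv₀ ha0).1 h1
    have hb1 : 1 ≤ b := by
      have h1 : b⁻¹ ≤ 1 := by nlinarith [hq.1]
      exact (inv_le_one₀ (ha0.trans_le hab)).1 h1
    have hba : 0 ≤ b - a := sub_nonneg.2 hab
    have hCr : C * r ^ n = (b - a) / a₀ := by rw [hd, hC]; ring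
    rw [hCr, Real.dist_eq, abs_sub_comm, ← Real.log_div (hpos _ x).ne' (hpos _ x).ne']
    have h1 : a ≤ u (n + 1) x / u n x := (le_div_iff₀ (hpos _ x)).2 (hx x).1
    have h2 : u (n + 1) x / u n x ≤ b := (div_le_iff₀ (hpos _ x)).2 (hx x).2
    rw [abs_le]
    constructor
    · have h3 := (Real.one_sub_inv_le_log_of_pos ha0).trans (Real.log_le_log ha0 h1)
      refine le_trans ?_ h3
      have h4 : (1 - a) / a ≤ (b - a) / a₀ := div_le_div₀ hba (by linarith) ha₀ ha
      have h5 : (1 - a) / a = a⁻¹ - 1 := by field_simp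
      linarith
    · have h3 := (Real.log_le_log (ha0.trans_le h1) h2).trans
        (Real.log_le_sub_one_of_pos (ha0.trans_le hab))
      refine h3.trans ?_
      rw [le_div_iff₀ ha₀]
      nlinarith
  have hlim : ∀ x, ∃ f, Tendsto (fun n => Real.log (u n x)) atTop (𝓝 f) := fun x =>
    cauchySeq_tendsto_of_complete (cauchySeq_of_le_geometric r C hr1 (hlog x))
  choose f hf using hlim
  have hulim : ∀ x, Tendsto (fun n => u n x) atTop (𝓝 (Real.exp (f x))) := fun x =>
    ((Real.continuous_exp.tendsto _).comp (hf x)).congr fun n => Real.exp_log (hpos n x)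
  set B := C / (1 - r) with hB
  have hB0 : 0 ≤ B := div_nonneg hC0 (sub_nonneg.2 hr1.le)
  have hfB : ∀ x, |f x| ≤ B := fun x => by
    have := dist_le_of_le_geometric_of_tendsto₀ r C hr1 (hlog x) (hf x)
    have e : Real.log (u 0 x) = 0 := by simp [hudef]
    rwa [e, Real.dist_eq, zero_sub, abs_neg] at this
  have hlogB : ∀ n x, |Real.log (u n x)| ≤ 2 * B := fun n x => by
    have h1 := dist_le_of_le_geometric_of_tendsto r C hr1 (hlog x) (hf x) n
    have h2 : C * r ^ n / (1 - r) ≤ B := by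
      refine div_le_div_of_nonneg_right ?_ (sub_nonneg.2 hr1.le)
      exact mul_le_of_le_one_right hC0 (pow_le_one₀ hr0 hr1.le)
    rw [Real.dist_eq] at h1
    have h3 := hfB x
    rw [abs_le] at *
    constructor <;> linarith
  have hul : ∀ n x, Real.exp (-(2 * B)) ≤ u n x := fun n x => by
    rw [← Real.exp_log (hpos n x)]; exact Real.exp_le_exp.2 (abs_le.1 (hlogB n x)).1
  have huL : ∀ n x, u n x ≤ Real.exp (2 * B) := fun n x => by
    rw [← Real.exp_log (hpos n x)]; exact Real.exp_le_exp.2 (abs_le.1 (hlogB n x)).2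
  refine ⟨fun x => Real.exp (f x), measurable_of_tendsto_metrizable hmeas (tendsto_pi_nhds.2 hulim),
    ⟨Real.exp (-(2 * B)), Real.exp (2 * B), Real.exp_pos _, fun x =>
      ⟨ge_of_tendsto' (hulim x) fun n => hul n x, le_of_tendsto' (hulim x) fun n => huL n x⟩⟩, ?_⟩
  ext x
  rcases isEmpty_or_nonempty Y with hY | ⟨⟨y₀⟩⟩
  · simp [Measure.eq_zero_of_isEmpty] at hβ
  have hvlim := tendsto_sinkhornStep hα hk hκ hk1 hk2 hmeas (Real.exp_pos _) hul huL hulim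
  have hsb := fun n => sinkhornStep_bounds hα hk hκ hk1 hk2 (hmeas n) (Real.exp_pos _) (hul n)
    (huL n)
  have hTlim := tendsto_sinkhornStep hβ hk' hκ (fun y x => hk1 x y) (fun y x => hk2 x y)
    (fun n => measurable_sinkhornStep hk (hmeas n)) (hsb 0 y₀).2.1
    (fun n y => (hsb n y).2.2.1) (fun n y => (hsb n y).2.2.2) hvlim x
  refine tendsto_nhds_unique hTlim ?_
  exact ((tendsto_add_atTop_iff_nat 1).2 (hulim x)).congr fun n => by rw [hsucc n]

/-- Normalized solutions of the Schrödinger system, with explicit bounds. -/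
lemma exists_schrodinger_system [IsFiniteMeasure α] [IsFiniteMeasure β]
    (hα : 0 < α.real Set.univ) (hαβ : α.real Set.univ = β.real Set.univ)
    (hk : Measurable (Function.uncurry k))
    (hκ : 0 < κ) (hκ1 : κ ≤ 1) (hk1 : ∀ x y, κ ≤ k x y) (hk2 : ∀ x y, k x y ≤ κ⁻¹) :
    ∃ (u : X → ℝ) (v : Y → ℝ), Measurable u ∧ Measurable v ∧
      (∀ x, κ ≤ u x ∧ u x ≤ κ⁻¹) ∧
      (∀ y, κ ^ 2 / α.real Set.univ ≤ v y ∧ v y ≤ (κ ^ 2 * α.real Set.univ)⁻¹) ∧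
      ∫ y, v y ∂β = 1 ∧
      (∀ x, u x * ∫ y, k x y * v y ∂β = 1) ∧ ∀ y, v y * ∫ x, k x y * u x ∂α = 1 := by
  have hβ : 0 < β.real Set.univ := hαβ ▸ hα
  have hk' : Measurable (Function.uncurry fun y x => k x y) := hk.comp measurable_swap
  obtain ⟨u, hu, ⟨l, L, hl0, hlL⟩, hfix⟩ :=
    exists_schrodinger_potentials hα hαβ hk hκ hκ1 hk1 hk2
  have hb := sinkhornStep_bounds hα hk hκ hk1 hk2 hu hl0 (fun x => (hlL x).1) (fun x => (hlL x).2)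
  have hv := measurable_sinkhornStep (α := α) hk hu
  have hvu : ∀ y, sinkhornStep k α u y * ∫ x, k x y * u x ∂α = 1 := fun y =>
    inv_mul_cancel₀ (hb y).1.ne'
  set v := sinkhornStep k α u
  rcases isEmpty_or_nonempty Y with hY | ⟨⟨y₀⟩⟩
  · simp [Measure.eq_zero_of_isEmpty] at hβ
  have hv0 : ∀ y, 0 < v y := fun y => (hb y).2.1.trans_le (hb y).2.2.1
  have hvi : Integrable v β :=
    integrable_of_bounds hv (fun y => (hb y).2.2.1) (fun y => (hb y).2.2.2)
  set s := ∫ y, v y ∂β with hs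
  have hs0 : 0 < s := (mul_pos hβ (hb y₀).2.1).trans_le
    (integral_mem_of_bounds hv (fun y => (hb y).2.2.1) (fun y => (hb y).2.2.2)).1
  have hkv : ∀ x, κ * s ≤ ∫ y, k x y * v y ∂β ∧ ∫ y, k x y * v y ∂β ≤ κ⁻¹ * s := fun x =>
    integral_kernel_mul_mem hk' hκ (fun y x => hk1 x y) (fun y x => hk2 x y) hvi
      (fun y => (hv0 y).le) x
  have hkv0 : ∀ x, 0 < ∫ y, k x y * v y ∂β := fun x => (mul_pos hκ hs0).trans_le (hkv x).1
  have hux : ∀ x, u x = (∫ y, k x y * v y ∂β)⁻¹ := fun x => (congrFun hfix x).symm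
  have hu1 : ∀ x, κ ≤ s * u x ∧ s * u x ≤ κ⁻¹ := by
    intro x
    rw [hux, ← div_eq_mul_inv, le_div_iff₀ (hkv0 x), div_le_iff₀ (hkv0 x)]
    constructor
    · have := mul_le_mul_of_nonneg_left (hkv x).2 hκ.le
      rwa [← mul_assoc, mul_inv_cancel₀ hκ.ne', one_mul] at this
    · have := mul_le_mul_of_nonneg_left (hkv x).1 (inv_pos.2 hκ).le
      rwa [← mul_assoc, inv_mul_cancel₀ hκ.ne', one_mul] at this
  have hsu : Measurable fun x => s * u x := hu.const_mul s
  have hkey : ∀ y, v y / s * ∫ x, k x y * (s * u x) ∂α = 1 := by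
    intro y
    simp_rw [mul_left_comm (k _ y) s]
    rw [integral_const_mul, ← mul_assoc, div_mul_cancel₀ _ hs0.ne', hvu]
  refine ⟨fun x => s * u x, fun y => v y / s, hsu, hv.div_const s, hu1, fun y => ?_, ?_,
    fun x => ?_, hkey⟩
  · obtain ⟨h1, -, h2, h3⟩ := sinkhornStep_bounds hα hk hκ hk1 hk2 hsu hκ (fun x => (hu1 x).1)
      (fun x => (hu1 x).2) y
    have e : v y / s = sinkhornStep k α (fun x => s * u x) y := eq_inv_of_mul_eq_one_left (hkey y)
    beta_reduce
    rw [e]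
    refine ⟨le_trans (le_of_eq ?_) h2, h3.trans (le_of_eq ?_)⟩
    · field_simp
    · congr 1; ring
  · rw [integral_div, ← hs, div_self hs0.ne']
  · simp_rw [← mul_div_assoc]
    rw [integral_div, hux]
    field_simp [(hkv0 x).ne']

end SchrodingerSystem

section CellProblem

lemma energy_eq_of_dens {Z : Type*} [MeasurableSpace Z] {ρ : Measure Z} [IsFiniteMeasure ρ]
    {c : Z → ℝ} (hc : Measurable c) {M : ℝ} (hcM : ∀ z, |c z| ≤ M) {ε : ℝ} (hε : 0 < ε)
    {p g L : Z → ℝ} (hpm : Measurable p) (h0 : ∀ z, 0 ≤ p z) [IsFiniteMeasure (dens ρ p)]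
    (hφ : Integrable (fun z => phiKL (p z)) ρ)
    (hq : Integrable (fun z => g z * Real.exp (-c z / ε)) ρ)
    (hL : Integrable L (dens ρ p))
    (hLg : ∀ᵐ z ∂(dens ρ p), 0 < g z ∧ L z = Real.log (g z)) :
    Integrable (fun z => g z * Real.exp (-c z / ε) *
      phiKL (p z / (g z * Real.exp (-c z / ε)))) ρ ∧
    (∀ᵐ z ∂ρ, g z * Real.exp (-c z / ε) = 0 → p z = 0) ∧
    energy c ε ρ p = ε * (relEnt ρ p (fun z => g z * Real.exp (-c z / ε))
      + ∫ z, L z ∂(dens ρ p) + ∫ z, (1 - g z * Real.exp (-c z / ε)) ∂ρ) := by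
  have hLg' : ∀ᵐ z ∂ρ, p z ≠ 0 → 0 < g z ∧ L z = Real.log (g z) := by
    rw [dens, ae_withDensity_iff hpm.ennreal_ofReal] at hLg
    filter_upwards [hLg] with z hz hp
    exact hz (by simpa using lt_of_le_of_ne (h0 z) (Ne.symm hp))
  have h := energy_eq_relEnt hc hcM hε (integrable_of_isFiniteMeasure_dens hpm h0) hφ hq
    ((integrable_dens_iff hpm h0).1 hL) hLg'
  refine ⟨h.1, ?_, by rw [integral_dens hpm h0]; exact h.2⟩
  filter_upwards [hLg'] with z hz hgz
  by_contra hp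
  exact (mul_pos (hz hp).1 (Real.exp_pos _)).ne' hgz

lemma integrable_phiKL_comp {Z : Type*} [MeasurableSpace Z] {ρ : Measure Z} [IsFiniteMeasure ρ]
    {p : Z → ℝ} (hp : Measurable p) (h0 : ∀ z, 0 ≤ p z) {M : ℝ} (hM : ∀ z, p z ≤ M) :
    Integrable (fun z => phiKL (p z)) ρ := by
  refine integrable_of_bounds (l := 0) (L := (M + 1) ^ 2)
    (continuous_phiKL.measurable.comp hp) (fun z => phiKL_nonneg (h0 z)) fun z =>
      (phiKL_le_sq (h0 z)).trans ?_
  exact sq_le_sq' (by linarith [h0 z, hM z]) (by linarith [hM z])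

variable {X Y : Type*} [MeasurableSpace X] [MeasurableSpace Y]

lemma map_fst_dens {α : Measure X} {ν : Measure Y} [IsFiniteMeasure α] [IsFiniteMeasure ν]
    {q : X × Y → ℝ} (hq : Measurable q) (h0 : ∀ z, 0 ≤ q z) {M : ℝ} (hM : ∀ z, q z ≤ M) :
    (dens (α.prod ν) q).map Prod.fst = dens α fun x => ∫ y, q (x, y) ∂ν := by
  ext s hs
  rw [Measure.map_apply measurable_fst hs, dens, withDensity_apply _ (measurable_fst hs), dens,
    withDensity_apply _ hs, show Prod.fst ⁻¹' s = s ×ˢ (Set.univ : Set Y) by ext; simp,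
    setLIntegral_prod _ hq.ennreal_ofReal.aemeasurable]
  refine lintegral_congr fun x => ?_
  have hm : Measurable fun y => q (x, y) := hq.comp measurable_prodMk_left
  rw [Measure.restrict_univ, ofReal_integral_eq_lintegral_ofReal (f := fun y => q (x, y))
    (integrable_of_bounds hm (fun y => h0 _) (fun y => hM _)) (ae_of_all _ fun y => h0 _)]

lemma map_snd_dens {α : Measure X} {ν : Measure Y} [IsFiniteMeasure α] [IsFiniteMeasure ν]
    {q : X × Y → ℝ} (hq : Measurable q) (h0 : ∀ z, 0 ≤ q z) {M : ℝ} (hM : ∀ z, q z ≤ M) :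
    (dens (α.prod ν) q).map Prod.snd = dens ν fun y => ∫ x, q (x, y) ∂α := by
  ext s hs
  rw [Measure.map_apply measurable_snd hs, dens, withDensity_apply _ (measurable_snd hs), dens,
    withDensity_apply _ hs, show Prod.snd ⁻¹' s = (Set.univ : Set X) ×ˢ s by ext; simp,
    setLIntegral_prod_symm _ hq.ennreal_ofReal.aemeasurable]
  refine lintegral_congr fun y => ?_
  have hm : Measurable fun x => q (x, y) := hq.comp measurable_prodMk_right
  rw [Measure.restrict_univ, ofReal_integral_eq_lintegral_ofReal (f := fun x => q (x, y))
    (integrable_of_bounds hm (fun x => h0 _) (fun x => hM _)) (ae_of_all _ fun x => h0 _)]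

lemma dens_one (α : Measure X) : dens α (fun _ => 1) = α := by
  simp [dens]

lemma exists_dens_of_le {β ν : Measure Y} [IsFiniteMeasure ν] (h : β ≤ ν) :
    ∃ n : Y → ℝ, Measurable n ∧ (∀ y, 0 ≤ n y ∧ n y ≤ 1) ∧ β = dens ν n := by
  have : IsFiniteMeasure β := isFiniteMeasure_of_le ν h
  refine ⟨fun y => min (β.rnDeriv ν y).toReal 1,
    (Measure.measurable_rnDeriv _ _).ennreal_toReal.min measurable_const,
    fun y => ⟨le_min ENNReal.toReal_nonneg zero_le_one, min_le_right _ _⟩, ?_⟩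
  conv_lhs => rw [← Measure.withDensity_rnDeriv_eq β ν (Measure.absolutelyContinuous_of_le h)]
  refine withDensity_congr_ae ?_
  filter_upwards [Measure.rnDeriv_le_one_of_le h] with y hy
  have h1 : (β.rnDeriv ν y).toReal ≤ 1 := ENNReal.toReal_le_of_le_ofReal zero_le_one (by simpa)
  rw [min_eq_left h1, ENNReal.ofReal_toReal (hy.trans_lt ENNReal.one_lt_top).ne]

/-- The minimizer of a cell problem has a density of the form `u(x) b(y) exp(-c(x,y)/ε)`, with
quantitative bounds on the factors. -/
lemma exists_factorization_of_minimizer {α : Measure X} {β ν : Measure Y} [IsFiniteMeasure α]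
    [IsFiniteMeasure ν] (hβν : β ≤ ν) (hα : 0 < α.real Set.univ)
    (hαβ : α.real Set.univ = β.real Set.univ)
    {c : X × Y → ℝ} (hc : Measurable c) {M : ℝ} (hcM : ∀ z, |c z| ≤ M) {ε : ℝ} (hε : 0 < ε)
    {κ : ℝ} (hκ : 0 < κ) (hκ1 : κ ≤ 1)
    (hk1 : ∀ z, κ ≤ Real.exp (-c z / ε)) (hk2 : ∀ z, Real.exp (-c z / ε) ≤ κ⁻¹)
    {π : Measure (X × Y)} (hπ : IsCoupling α β π)
    (hmin : ∀ σ, IsCoupling α β σ → EOT c ε α ν π ≤ EOT c ε α ν σ) :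
    ∃ (u : X → ℝ) (b : Y → ℝ), Measurable u ∧ Measurable b ∧ (∀ x, κ ≤ u x ∧ u x ≤ κ⁻¹) ∧
      (∀ y, 0 ≤ b y ∧ b y ≤ (κ ^ 2 * α.real Set.univ)⁻¹) ∧ ∫ y, b y ∂ν = 1 ∧
      Integrable (fun y => Real.log (b y)) β ∧ (∀ᵐ y ∂β, 0 < b y) ∧
      π = dens (α.prod ν) (fun z => u z.1 * b z.2 * Real.exp (-c z / ε)) := by
  have : IsFiniteMeasure β := isFiniteMeasure_of_le ν hβν
  obtain ⟨n, hn, hn01, hβn⟩ := exists_dens_of_le hβν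
  have hexp : Measurable fun z => Real.exp (-c z / ε) :=
    Real.measurable_exp.comp (hc.neg.div_const ε)
  obtain ⟨u, v, hu, hv, hub, hvb, hv1, hux, hvy⟩ := exists_schrodinger_system
    (k := fun x y => Real.exp (-c (x, y) / ε)) hα hαβ hexp hκ hκ1
    (fun x y => hk1 _) (fun x y => hk2 _)
  set m := α.real Set.univ
  have hv0 : ∀ y, 0 < v y := fun y => lt_of_lt_of_le (by positivity) (hvb y).1
  have hu0 : ∀ x, 0 < u x := fun x => hκ.trans_le (hub x).1
  have hb : Measurable fun y => v y * n y := hv.mul hn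
  have hbb : ∀ y, 0 ≤ v y * n y ∧ v y * n y ≤ (κ ^ 2 * m)⁻¹ := fun y =>
    ⟨mul_nonneg (hv0 y).le (hn01 y).1,
      (mul_le_of_le_one_right (hv0 y).le (hn01 y).2).trans (hvb y).2⟩
  have hlogb : Integrable (fun y => Real.log (v y * n y)) β := by
    rw [hβn, integrable_dens_iff hn fun y => (hn01 y).1]
    refine Integrable.of_bound (hn.mul (Real.measurable_log.comp hb)).aestronglyMeasurable
      ((((κ ^ 2 * m)⁻¹ + 1) ^ 2 + (κ ^ 2 * m)⁻¹ + 1) * (κ ^ 2 / m)⁻¹) (ae_of_all _ fun y => ?_)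
    have e : n y * Real.log (v y * n y) = (v y * n y) * Real.log (v y * n y) * (v y)⁻¹ := by
      field_simp [(hv0 y).ne']
    obtain ⟨h1, h2⟩ := hbb y
    rw [e, norm_mul, Real.norm_eq_abs, Real.norm_eq_abs, abs_of_pos (inv_pos.2 (hv0 y))]
    have h3 := phiKL_nonneg h1
    have h4 := (phiKL_le_sq h1).trans (sq_le_sq' (b := (κ ^ 2 * m)⁻¹ + 1) (by linarith)
      (by linarith))
    refine mul_le_mul ?_ (inv_anti₀ (by positivity) (hvb y).1) (inv_pos.2 (hv0 y)).le
      (by positivity)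
    unfold phiKL at h3 h4
    rw [abs_le]
    constructor
    · have : 0 ≤ ((κ ^ 2 * m)⁻¹ + 1) ^ 2 := sq_nonneg _
      linarith
    · linarith
  have hbpos : ∀ᵐ y ∂β, 0 < v y * n y := by
    rw [hβn, dens, ae_withDensity_iff hn.ennreal_ofReal]
    refine ae_of_all _ fun y hy => mul_pos (hv0 y) ?_
    simpa using hy
  refine ⟨u, fun y => v y * n y, hu, hb, hub, hbb, ?_, hlogb, hbpos, ?_⟩
  · rw [← hv1, hβn, integral_dens hn fun y => (hn01 y).1]
    simp_rw [mul_comm]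
  set g : X × Y → ℝ := fun z => u z.1 * (v z.2 * n z.2) with hg
  set q : X × Y → ℝ := fun z => g z * Real.exp (-c z / ε) with hqdef
  set L : X × Y → ℝ := fun z => Real.log (u z.1) + Real.log (v z.2 * n z.2) with hLdef
  have hgm : Measurable g := (hu.comp measurable_fst).mul (hb.comp measurable_snd)
  have hqm : Measurable q := hgm.mul hexp
  have hq0 : ∀ z, 0 ≤ q z := fun z =>
    mul_nonneg (mul_nonneg (hu0 _).le (hbb _).1) (Real.exp_pos _).le
  have hqM : ∀ z, q z ≤ κ⁻¹ * (κ ^ 2 * m)⁻¹ * κ⁻¹ := fun z =>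
    mul_le_mul (mul_le_mul (hub _).2 (hbb _).2 (hbb _).1 (inv_pos.2 hκ).le) (hk2 z)
      (Real.exp_pos _).le (by positivity)
  have hqi : Integrable q (α.prod ν) := integrable_of_bounds hqm hq0 hqM
  have hqφ := integrable_phiKL_comp (ρ := α.prod ν) hqm hq0 hqM
  have hqc : IsCoupling α β (dens (α.prod ν) q) := by
    constructor
    · rw [map_fst_dens hqm hq0 hqM]
      conv_rhs => rw [← dens_one α]
      congr 1
      ext x
      rw [← hux x, hβn, integral_dens hn (fun y => (hn01 y).1), ← integral_const_mul]
      refine integral_congr_ae (ae_of_all _ fun y => ?_)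
      simp only [hqdef, hg]; ring
    · rw [map_snd_dens hqm hq0 hqM, hβn]
      congr 1
      ext y
      calc ∫ x, q (x, y) ∂α = n y * (v y * ∫ x, Real.exp (-c (x, y) / ε) * u x ∂α) := by
            rw [← integral_const_mul, ← integral_const_mul]
            refine integral_congr_ae (ae_of_all _ fun x => ?_)
            simp only [hqdef, hg]; ring
        _ = n y := by rw [hvy, mul_one]
  have hfin : ∀ σ : Measure (X × Y), IsCoupling α β σ → IsFiniteMeasure σ := by
    intro σ hσ
    refine ⟨?_⟩
    have h := measure_lt_top α Set.univ
    rwa [← hσ.1, Measure.map_apply measurable_fst MeasurableSet.univ, Set.preimage_univ] at h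
  have hlogu : Integrable (fun x => Real.log (u x)) α :=
    integrable_of_bounds (Real.measurable_log.comp hu)
      (fun x => Real.log_le_log hκ (hub x).1) (fun x => Real.log_le_log (hu0 x) (hub x).2)
  have hlu : Measurable fun x => Real.log (u x) := Real.measurable_log.comp hu
  have hlb : Measurable fun y => Real.log (v y * n y) := Real.measurable_log.comp hb
  have hLint : ∀ σ : Measure (X × Y), IsCoupling α β σ → Integrable L σ ∧
      ∫ z, L z ∂σ = ∫ x, Real.log (u x) ∂α + ∫ y, Real.log (v y * n y) ∂β ∧
      ∀ᵐ z ∂σ, 0 < g z ∧ L z = Real.log (g z) := by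
    intro σ hσ
    have h1 : Integrable (fun z : X × Y => Real.log (u z.1)) σ := by
      have := hlogu; rw [← hσ.1] at this; exact this.comp_measurable measurable_fst
    have h2 : Integrable (fun z : X × Y => Real.log (v z.2 * n z.2)) σ := by
      have := hlogb; rw [← hσ.2] at this; exact this.comp_measurable measurable_snd
    refine ⟨h1.add h2, ?_, ?_⟩
    · rw [hLdef, integral_add h1 h2]
      congr 1
      · conv_rhs => rw [← hσ.1]
        rw [integral_map measurable_fst.aemeasurable hlu.aestronglyMeasurable]
      · conv_rhs => rw [← hσ.2]
        rw [integral_map measurable_snd.aemeasurable hlb.aestronglyMeasurable]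
    · have h3 := hbpos
      rw [← hσ.2] at h3
      filter_upwards [ae_of_ae_map measurable_snd.aemeasurable h3] with z hz
      exact ⟨mul_pos (hu0 _) hz, (Real.log_mul (hu0 _).ne' hz.ne').symm⟩
  have := hfin _ hπ
  have hle := hmin _ hqc
  rw [EOT_dens hqm hq0 hqφ] at hle
  obtain ⟨p, hp, hp0, hpi, hpφ, hπp⟩ :=
    exists_dens_of_EOT_ne_top hε (hle.trans_lt (EReal.coe_lt_top _)).ne
  rw [hπp, EOT_dens hp hp0 hpφ, EReal.coe_le_coe_iff] at hle
  rw [hπp] at hπ ⊢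
  have := hfin _ hπ
  have := hfin _ hqc
  obtain ⟨hL1, hL2, hL3⟩ := hLint _ hπ
  obtain ⟨hL4, hL5, hL6⟩ := hLint _ hqc
  obtain ⟨h1, h2, h3⟩ := energy_eq_of_dens hc hcM hε hp hp0 hpφ hqi hL1 hL3
  obtain ⟨-, -, h6⟩ := energy_eq_of_dens hc hcM hε hqm hq0 hqφ hqi hL4 hL6
  change energy c ε _ q = ε * (relEnt _ q q + _ + _) at h6
  rw [h3, h6, hL2, hL5, relEnt_self] at hle
  have hle' := le_of_mul_le_mul_left hle hε
  refine dens_congr (ae_eq_of_relEnt_le_zero hp0 hq0 hpi hqi h2 h1 ?_)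
  linarith

end CellProblem

section Step

variable {X Y K : Type*} [MeasurableSpace X] [MeasurableSpace Y]

lemma IsCoupling.isFiniteMeasure {μ : Measure X} {ν : Measure Y} [IsFiniteMeasure μ]
    {π : Measure (X × Y)} (h : IsCoupling μ ν π) : IsFiniteMeasure π := by
  refine ⟨?_⟩
  have h' := measure_lt_top μ Set.univ
  rwa [← h.1, Measure.map_apply measurable_fst MeasurableSet.univ, Set.preimage_univ] at h'

lemma IsCoupling.map_fst_restrict {μ : Measure X} {ν : Measure Y} {π : Measure (X × Y)}
    (h : IsCoupling μ ν π) {s : Set X} (hs : MeasurableSet s) :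
    (π.restrict (s ×ˢ Set.univ)).map Prod.fst = μ.restrict s := by
  rw [← h.1, Measure.restrict_map measurable_fst hs]
  congr 2
  ext; simp

lemma IsCoupling.map_snd_restrict_le {μ : Measure X} {ν : Measure Y} {π : Measure (X × Y)}
    (h : IsCoupling μ ν π) (s : Set (X × Y)) :
    (π.restrict s).map Prod.snd ≤ ν := by
  conv_rhs => rw [← h.2]
  exact Measure.map_mono Measure.restrict_le_self measurable_snd

lemma IsCoupling.restrict_eq_zero {μ : Measure X} {ν : Measure Y} {π : Measure (X × Y)}
    (h : IsCoupling μ ν π) {s : Set X} (hs : μ s = 0) :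
    π.restrict (s ×ˢ Set.univ) = 0 := by
  rw [Measure.restrict_eq_zero]
  have h1 : π (Prod.fst ⁻¹' s) = 0 := by
    rw [← h.1] at hs
    exact Measure.preimage_null_of_map_null measurable_fst.aemeasurable hs
  refine measure_mono_null ?_ h1
  rintro z ⟨hz, -⟩
  exact hz

lemma exists_cell_factorization {μ : Measure X} {ν : Measure Y} [IsFiniteMeasure μ]
    [IsFiniteMeasure ν] {c : X × Y → ℝ} (hc : Measurable c) {M : ℝ} (hcM : ∀ z, |c z| ≤ M)
    {ε : ℝ} (hε : 0 < ε) {κ : ℝ} (hκ : 0 < κ) (hκ1 : κ ≤ 1)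
    (hk1 : ∀ z, κ ≤ Real.exp (-c z / ε)) (hk2 : ∀ z, Real.exp (-c z / ε) ≤ κ⁻¹)
    {π π' : Measure (X × Y)} (hπ : IsCoupling μ ν π)
    {m₀ : ℝ} (hm₀ : 0 < m₀) {s : Set X} (hs : MeasurableSet s) (hms : m₀ ≤ μ.real s)
    (hcell : CellSolve c ε ν π π' s) :
    ∃ (u : X → ℝ) (b : Y → ℝ), Measurable u ∧ Measurable b ∧ (∀ x, κ ≤ u x ∧ u x ≤ κ⁻¹) ∧
      (∀ y, 0 ≤ b y ∧ b y ≤ (κ ^ 2 * m₀)⁻¹) ∧ ∫ y, b y ∂ν = 1 ∧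
      Integrable (fun y => Real.log (b y)) ((π.restrict (s ×ˢ Set.univ)).map Prod.snd) ∧
      (∀ᵐ y ∂((π.restrict (s ×ˢ Set.univ)).map Prod.snd), 0 < b y) ∧
      π'.restrict (s ×ˢ Set.univ) = (dens (μ.prod ν)
        (fun z => u z.1 * b z.2 * Real.exp (-c z / ε))).restrict (s ×ˢ Set.univ) := by
  have hα := hπ.map_fst_restrict hs
  obtain ⟨h1, h2⟩ := hcell
  rw [hα] at h1 h2
  have hmass : (μ.restrict s).real Set.univ = μ.real s := by simp
  have hαβ : (μ.restrict s).real Set.univ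
      = ((π.restrict (s ×ˢ Set.univ)).map Prod.snd).real Set.univ := by
    rw [← hα]
    simp only [Measure.real, Measure.map_apply measurable_fst MeasurableSet.univ,
      Measure.map_apply measurable_snd MeasurableSet.univ, Set.preimage_univ]
  obtain ⟨u, b, hu, hb, hub, hbb, hb1, hbl, hbp, he⟩ := exists_factorization_of_minimizer
    (hπ.map_snd_restrict_le _) (by rw [hmass]; exact hm₀.trans_le hms) hαβ hc hcM hε hκ hκ1
    hk1 hk2 h1 h2
  refine ⟨u, b, hu, hb, hub, fun y => ⟨(hbb y).1, (hbb y).2.trans ?_⟩, hb1, hbl, hbp, ?_⟩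
  · rw [hmass]
    exact inv_anti₀ (by positivity) (mul_le_mul_of_nonneg_left hms (by positivity))
  · rw [he, dens, dens, restrict_withDensity (hs.prod MeasurableSet.univ), ← Measure.prod_restrict,
      Measure.restrict_univ]

variable [Fintype K] [MeasurableSpace K] [MeasurableSingletonClass K]

lemma integral_label_eq_sum {σ : Measure (X × Y)} {l : X → K} (hl : Measurable l)
    {F : K → Y → ℝ} (hF : ∀ k, Measurable (F k))
    (hint : ∀ k, Integrable (F k) ((σ.restrict ((l ⁻¹' {k}) ×ˢ Set.univ)).map Prod.snd)) :
    Integrable (fun z => F (l z.1) z.2) σ ∧ ∫ z, F (l z.1) z.2 ∂σ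
      = ∑ k, ∫ y, F k y ∂((σ.restrict ((l ⁻¹' {k}) ×ˢ Set.univ)).map Prod.snd) := by
  have hs : ∀ k, MeasurableSet ((l ⁻¹' {k}) ×ˢ (Set.univ : Set Y)) := fun k =>
    (hl (measurableSet_singleton k)).prod MeasurableSet.univ
  have hU : ⋃ k, (l ⁻¹' {k}) ×ˢ (Set.univ : Set Y) = Set.univ := by
    ext z; simp
  have hcongr : ∀ k, ∀ z ∈ (l ⁻¹' {k}) ×ˢ (Set.univ : Set Y), F k z.2 = F (l z.1) z.2 := by
    rintro k z ⟨hz, -⟩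
    rw [show l z.1 = k from hz]
  have hon : ∀ k, IntegrableOn (fun z => F (l z.1) z.2) ((l ⁻¹' {k}) ×ˢ (Set.univ : Set Y)) σ :=
    fun k => IntegrableOn.congr_fun ((hint k).comp_measurable measurable_snd) (hcongr k) (hs k)
  refine ⟨?_, ?_⟩
  · rw [← integrableOn_univ, ← hU]
    exact integrableOn_finite_iUnion.2 hon
  · rw [← setIntegral_univ, ← hU, integral_iUnion_fintype hs ?_ hon]
    · refine Finset.sum_congr rfl fun k _ => ?_
      rw [integral_map measurable_snd.aemeasurable (hF k).aestronglyMeasurable]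
      exact (setIntegral_congr_fun (hs k) (hcongr k)).symm
    · intro i j hij
      refine Set.disjoint_left.2 ?_
      rintro z ⟨hz, -⟩ ⟨hz', -⟩
      exact hij (hz.symm.trans hz')

end Step

section Projection

variable {X Y K : Type*} [MeasurableSpace X] [MeasurableSpace Y]
  [Fintype K] [MeasurableSpace K] [MeasurableSingletonClass K]

lemma measurable_label {l : X → K} (hl : Measurable l) {b : K → Y → ℝ}
    (hb : ∀ k, Measurable (b k)) : Measurable fun z : X × Y => b (l z.1) z.2 := by
  have h : Measurable fun w : K × Y => b w.1 w.2 := measurable_from_prod_countable_right hb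
  exact h.comp ((hl.comp measurable_fst).prodMk measurable_snd)

lemma integrable_log_of_bounds {μ : Measure X} [IsFiniteMeasure μ] {u : X → ℝ} {l L : ℝ}
    (hu : Measurable u) (hl : 0 < l) (h : ∀ x, l ≤ u x ∧ u x ≤ L) :
    Integrable (fun x => Real.log (u x)) μ :=
  integrable_of_bounds (Real.measurable_log.comp hu) (fun x => Real.log_le_log hl (h x).1)
    (fun x => Real.log_le_log (hl.trans_le (h x).1) (h x).2)

/-- One domain decomposition half iteration: the new iterate has a density which factorizes on
every cell, and it satisfies a Pythagorean identity relative to the previous iterate. -/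
lemma exists_step_density {μ : Measure X} {ν : Measure Y} [IsFiniteMeasure μ]
    [IsFiniteMeasure ν] {c : X × Y → ℝ} (hc : Measurable c) {M : ℝ} (hcM : ∀ z, |c z| ≤ M)
    {ε : ℝ} (hε : 0 < ε) {κ : ℝ} (hκ : 0 < κ) (hκ1 : κ ≤ 1)
    (hk1 : ∀ z, κ ≤ Real.exp (-c z / ε)) (hk2 : ∀ z, Real.exp (-c z / ε) ≤ κ⁻¹)
    {π π' : Measure (X × Y)} (hπ : IsCoupling μ ν π) (hπ' : IsCoupling μ ν π')
    {l : X → K} (hl : Measurable l) {m₀ : ℝ} (hm₀ : 0 < m₀)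
    (hml : ∀ k, μ (l ⁻¹' {k}) = 0 ∨ m₀ ≤ μ.real (l ⁻¹' {k}))
    (hcell : ∀ k, m₀ ≤ μ.real (l ⁻¹' {k}) → CellSolve c ε ν π π' (l ⁻¹' {k})) :
    ∃ (u : X → ℝ) (b : K → Y → ℝ) (q : X × Y → ℝ),
      (q = fun z => u z.1 * b (l z.1) z.2 * Real.exp (-c z / ε)) ∧
      Measurable u ∧ (∀ k, Measurable (b k)) ∧ (∀ x, κ ≤ u x ∧ u x ≤ κ⁻¹) ∧
      (∀ k y, 0 ≤ b k y ∧ b k y ≤ (κ ^ 2 * m₀)⁻¹) ∧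
      (∀ k, m₀ ≤ μ.real (l ⁻¹' {k}) → ∫ y, b k y ∂ν = 1) ∧
      Measurable q ∧ (∀ z, 0 ≤ q z ∧ q z ≤ κ⁻¹ * (κ ^ 2 * m₀)⁻¹ * κ⁻¹) ∧
      π' = dens (μ.prod ν) q ∧
      ∀ p : X × Y → ℝ, Measurable p → (∀ z, 0 ≤ p z) →
        Integrable (fun z => phiKL (p z)) (μ.prod ν) → π = dens (μ.prod ν) p →
        Integrable (fun z => q z * phiKL (p z / q z)) (μ.prod ν) ∧
        (∀ᵐ z ∂(μ.prod ν), q z = 0 → p z = 0) ∧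
        energy c ε (μ.prod ν) p = energy c ε (μ.prod ν) q + ε * relEnt (μ.prod ν) p q := by
  have hs : ∀ k, MeasurableSet (l ⁻¹' {k}) := fun k => hl (measurableSet_singleton k)
  have hs' : ∀ k, MeasurableSet ((l ⁻¹' {k}) ×ˢ (Set.univ : Set Y)) := fun k =>
    (hs k).prod MeasurableSet.univ
  have hU : ⋃ k, (l ⁻¹' {k}) ×ˢ (Set.univ : Set Y) = Set.univ := by
    ext z; simp
  have hfac : ∀ k, ∃ (u : X → ℝ) (b : Y → ℝ), Measurable u ∧ Measurable b ∧
      (∀ x, κ ≤ u x ∧ u x ≤ κ⁻¹) ∧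
      (∀ y, 0 ≤ b y ∧ b y ≤ (κ ^ 2 * m₀)⁻¹) ∧
      (m₀ ≤ μ.real (l ⁻¹' {k}) → ∫ y, b y ∂ν = 1) ∧
      Integrable (fun y => Real.log (b y))
        ((π.restrict ((l ⁻¹' {k}) ×ˢ Set.univ)).map Prod.snd) ∧
      (∀ᵐ y ∂((π.restrict ((l ⁻¹' {k}) ×ˢ Set.univ)).map Prod.snd), 0 < b y) ∧
      π'.restrict ((l ⁻¹' {k}) ×ˢ Set.univ) = (dens (μ.prod ν)
        (fun z => u z.1 * b z.2 * Real.exp (-c z / ε))).restrict ((l ⁻¹' {k}) ×ˢ Set.univ) ∧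
      (π'.restrict ((l ⁻¹' {k}) ×ˢ Set.univ)).map Prod.snd
        = (π.restrict ((l ⁻¹' {k}) ×ˢ Set.univ)).map Prod.snd := by
    intro k
    by_cases h : m₀ ≤ μ.real (l ⁻¹' {k})
    · obtain ⟨u, b, h1, h2, h3, h4, h5, h6, h7, h8⟩ := exists_cell_factorization hc hcM hε hκ hκ1
        hk1 hk2 hπ hm₀ (hs k) h (hcell k h)
      exact ⟨u, b, h1, h2, h3, h4, fun _ => h5, h6, h7, h8, (hcell k h).1.2⟩
    · have h0 := (hml k).resolve_right h
      have hz := hπ.restrict_eq_zero h0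
      have hz' := hπ'.restrict_eq_zero h0
      refine ⟨fun _ => 1, fun _ => 0, measurable_const, measurable_const,
        fun _ => ⟨hκ1, (one_le_inv₀ hκ).2 hκ1⟩, fun _ => ⟨le_rfl, by positivity⟩,
        fun h' => absurd h' h, ?_, ?_, ?_, ?_⟩
      · simp
      · simp [hz]
      · rw [hz']
        simp [dens]
      · rw [hz, hz']
  choose u b hu hb hub hbb hb1 hbl hbp hform hsnd using hfac
  set q : X × Y → ℝ := fun z => u (l z.1) z.1 * b (l z.1) z.2 * Real.exp (-c z / ε) with hq
  have huu : Measurable fun x => u (l x) x := by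
    have h : Measurable fun w : K × X => u w.1 w.2 := measurable_from_prod_countable_right hu
    exact h.comp (hl.prodMk measurable_id)
  have hbl' := measurable_label hl hb
  have hqm : Measurable q := ((huu.comp measurable_fst).mul hbl').mul
    (Real.measurable_exp.comp (hc.neg.div_const ε))
  have hu0 : ∀ k x, 0 < u k x := fun k x => hκ.trans_le (hub k x).1
  have hq0 : ∀ z, 0 ≤ q z := fun z =>
    mul_nonneg (mul_nonneg (hu0 _ _).le (hbb _ _).1) (Real.exp_pos _).le
  have hqM : ∀ z, q z ≤ κ⁻¹ * (κ ^ 2 * m₀)⁻¹ * κ⁻¹ := fun z =>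
    mul_le_mul (mul_le_mul (hub _ _).2 (hbb _ _).2 (hbb _ _).1 (inv_pos.2 hκ).le) (hk2 z)
      (Real.exp_pos _).le (by positivity)
  have hqi : Integrable q (μ.prod ν) := integrable_of_bounds hqm hq0 hqM
  have hqφ := integrable_phiKL_comp (ρ := μ.prod ν) hqm hq0 hqM
  have hπ'q : π' = dens (μ.prod ν) q := by
    refine Measure.ext_of_iUnion_eq_univ hU fun k => ?_
    rw [hform k, dens, dens, restrict_withDensity (hs' k), restrict_withDensity (hs' k)]
    refine withDensity_congr_ae ?_
    filter_upwards [ae_restrict_mem (hs' k)] with z hz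
    have hz1 : l z.1 = k := hz.1
    simp only [hq, hz1]
  refine ⟨fun x => u (l x) x, b, q, rfl, huu, hb, fun x => hub _ _, hbb, hb1, hqm,
    fun z => ⟨hq0 z, hqM z⟩, hπ'q, ?_⟩
  have hlogu : Integrable (fun x => Real.log (u (l x) x)) μ :=
    integrable_log_of_bounds huu hκ fun x => hub _ _
  have hlog : ∀ σ : Measure (X × Y), IsCoupling μ ν σ →
      (∀ k, (σ.restrict ((l ⁻¹' {k}) ×ˢ Set.univ)).map Prod.snd
        = (π.restrict ((l ⁻¹' {k}) ×ˢ Set.univ)).map Prod.snd) →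
      Integrable (fun z => Real.log (u (l z.1) z.1) + Real.log (b (l z.1) z.2)) σ ∧
      ∫ z, (Real.log (u (l z.1) z.1) + Real.log (b (l z.1) z.2)) ∂σ
        = ∫ x, Real.log (u (l x) x) ∂μ + ∑ k, ∫ y, Real.log (b k y)
          ∂((π.restrict ((l ⁻¹' {k}) ×ˢ Set.univ)).map Prod.snd) ∧
      ∀ᵐ z ∂σ, 0 < u (l z.1) z.1 * b (l z.1) z.2 ∧
        Real.log (u (l z.1) z.1) + Real.log (b (l z.1) z.2)
          = Real.log (u (l z.1) z.1 * b (l z.1) z.2) := by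
    intro σ hσ hσk
    have h1 : Integrable (fun z : X × Y => Real.log (u (l z.1) z.1)) σ := by
      have := hlogu; rw [← hσ.1] at this; exact this.comp_measurable measurable_fst
    obtain ⟨h2, h3⟩ := integral_label_eq_sum (σ := σ) hl (F := fun k y => Real.log (b k y))
      (fun k => Real.measurable_log.comp (hb k)) (fun k => by rw [hσk k]; exact hbl k)
    have hlu : Measurable fun x => Real.log (u (l x) x) := Real.measurable_log.comp huu
    refine ⟨h1.add h2, ?_, ?_⟩
    · rw [integral_add h1 h2, h3]
      congr 1
      · conv_rhs => rw [← hσ.1]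
        rw [integral_map measurable_fst.aemeasurable hlu.aestronglyMeasurable]
      · simp_rw [hσk]
    · have h4 : ∀ᵐ z ∂σ, 0 < b (l z.1) z.2 := by
        rw [← Measure.restrict_univ (μ := σ), ← hU, ae_restrict_iUnion_iff]
        intro k
        have h5 := hbp k
        rw [← hσk k] at h5
        filter_upwards [ae_of_ae_map measurable_snd.aemeasurable h5,
          ae_restrict_mem (hs' k)] with z hz hzk
        have hz1 : l z.1 = k := hzk.1
        rwa [hz1]
      filter_upwards [h4] with z hz
      exact ⟨mul_pos (hu0 _ _) hz, (Real.log_mul (hu0 _ _).ne' hz.ne').symm⟩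
  intro p hp hp0 hpφ hπp
  obtain ⟨hL1, hL2, hL3⟩ := hlog π hπ fun _ => rfl
  obtain ⟨hL4, hL5, hL6⟩ := hlog π' hπ' hsnd
  have := hπ.isFiniteMeasure
  have := hπ'.isFiniteMeasure
  rw [hπp] at hL1 hL3
  rw [hπ'q] at hL4 hL6
  have : IsFiniteMeasure (dens (μ.prod ν) p) := by rwa [← hπp]
  have : IsFiniteMeasure (dens (μ.prod ν) q) := by rwa [← hπ'q]
  obtain ⟨h1, h2, h3⟩ := energy_eq_of_dens hc hcM hε hp hp0 hpφ hqi hL1 hL3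
  obtain ⟨-, -, h6⟩ := energy_eq_of_dens hc hcM hε hqm hq0 hqφ hqi hL4 hL6
  refine ⟨h1, h2, ?_⟩
  change energy c ε _ q = ε * (relEnt _ q q + _ + _) at h6
  rw [← hπp] at h3
  rw [← hπ'q] at h6
  rw [h3, h6, hL2, hL5, relEnt_self]
  ring

end Projection

section Estimates

variable {X Y I : Type*} [MeasurableSpace X] [MeasurableSpace Y]
  {μ : Measure X} {ν : Measure Y} [IsProbabilityMeasure μ] [IsProbabilityMeasure ν]

lemma integral_abs_sub_triangle {Z : Type*} [MeasurableSpace Z] {ρ : Measure Z}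
    {p q r : Z → ℝ} (hp : Integrable p ρ) (hq : Integrable q ρ) (hr : Integrable r ρ) :
    ∫ z, |p z - r z| ∂ρ ≤ ∫ z, |p z - q z| ∂ρ + ∫ z, |q z - r z| ∂ρ := by
  have h1 : Integrable (fun z => |p z - q z|) ρ := (hp.sub hq).abs
  have h2 : Integrable (fun z => |q z - r z|) ρ := (hq.sub hr).abs
  rw [← integral_add h1 h2]
  exact integral_mono (hp.sub hr).abs (h1.add h2) fun z => abs_sub_le _ _ _

/-- Factors normalized to mass one can be compared through the densities they generate. -/
lemma integral_abs_sub_le_of_factorization {a b : Y → ℝ} {u v : X → ℝ} {k p q : X × Y → ℝ}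
    {s : Set X} {κ B : ℝ} (hs : MeasurableSet s) (hκ : 0 < κ) (hk : ∀ z, κ ≤ k z)
    (hu : ∀ x, κ ≤ u x) (ha : Integrable a ν) (hb : Integrable b ν)
    (hb0 : ∀ y, 0 ≤ b y) (ha1 : ∫ y, a y ∂ν = 1) (hb1 : ∫ y, b y ∂ν = 1)
    (hp : Measurable p) (hq : Measurable q) (hpB : ∀ z, 0 ≤ p z ∧ p z ≤ B)
    (hqB : ∀ z, 0 ≤ q z ∧ q z ≤ B)
    (hps : ∀ x ∈ s, ∀ y, p (x, y) = u x * a y * k (x, y))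
    (hqs : ∀ x ∈ s, ∀ y, q (x, y) = v x * b y * k (x, y)) :
    μ.real s * (κ ^ 2 / 2 * ∫ y, |a y - b y| ∂ν) ≤ ∫ z, |p z - q z| ∂(μ.prod ν) := by
  have hpi : Integrable p (μ.prod ν) :=
    integrable_of_bounds hp (fun z => (hpB z).1) fun z => (hpB z).2
  have hqi : Integrable q (μ.prod ν) :=
    integrable_of_bounds hq (fun z => (hqB z).1) fun z => (hqB z).2
  have hint : Integrable (fun z => |p z - q z|) (μ.prod ν) := (hpi.sub hqi).abs
  rw [integral_prod _ hint]
  have hint' := hint.integral_prod_left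
  refine le_trans ?_ (setIntegral_le_integral hint'
    (ae_of_all _ fun x => integral_nonneg fun y => abs_nonneg _) (s := s))
  rw [mul_comm]
  refine setIntegral_ge_of_const_le_real hs (measure_ne_top _ _) (fun x hx => ?_) hint'.integrableOn
  have hd : Integrable (fun y => u x * a y - v x * b y) ν := (ha.const_mul _).sub (hb.const_mul _)
  have h1 : κ * ∫ y, |u x * a y - v x * b y| ∂ν ≤ ∫ y, |p (x, y) - q (x, y)| ∂ν := by
    rw [← integral_const_mul]
    refine integral_mono_of_nonneg (ae_of_all _ fun y => by positivity)
      ?_ (ae_of_all _ fun y => ?_)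
    · have hpx : Measurable fun y => p (x, y) := hp.comp measurable_prodMk_left
      have hqx : Measurable fun y => q (x, y) := hq.comp measurable_prodMk_left
      exact ((integrable_of_bounds hpx (fun y => (hpB _).1) fun y => (hpB _).2).sub
        (integrable_of_bounds hqx (fun y => (hqB _).1) fun y => (hqB _).2)).abs
    · simp only
      rw [hps x hx, hqs x hx, ← sub_mul, abs_mul, mul_comm, abs_of_pos (hκ.trans_le (hk (x, y)))]
      exact mul_le_mul_of_nonneg_left (hk _) (abs_nonneg _)
  have h2 : |u x - v x| ≤ ∫ y, |u x * a y - v x * b y| ∂ν := by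
    have : u x - v x = ∫ y, (u x * a y - v x * b y) ∂ν := by
      rw [integral_sub (ha.const_mul _) (hb.const_mul _), integral_const_mul, integral_const_mul,
        ha1, hb1, mul_one, mul_one]
    rw [this]
    exact abs_integral_le_integral_abs
  have hb' : ∫ y, |b y| ∂ν = 1 := by simp_rw [abs_of_nonneg (hb0 _), hb1]
  have h3 : u x * ∫ y, |a y - b y| ∂ν ≤
      ∫ y, |u x * a y - v x * b y| ∂ν + |u x - v x| * ∫ y, |b y| ∂ν := by
    rw [← integral_const_mul, ← integral_const_mul,
      ← integral_add hd.abs (hb.abs.const_mul _)]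
    refine integral_mono (((ha.sub hb).abs).const_mul _) (hd.abs.add (hb.abs.const_mul _))
      fun y => ?_
    have h0 : 0 < u x := hκ.trans_le (hu x)
    calc u x * |a y - b y| = |(u x * a y - v x * b y) + (-((u x - v x) * b y))| := by
          rw [← abs_of_pos h0, ← abs_mul, abs_of_pos h0]; congr 1; ring
      _ ≤ |u x * a y - v x * b y| + |-((u x - v x) * b y)| := abs_add_le _ _
      _ = _ := by rw [abs_neg, abs_mul]
  rw [hb', mul_one] at h3
  have hD : 0 ≤ ∫ y, |a y - b y| ∂ν := integral_nonneg fun y => abs_nonneg _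
  have h4 := mul_le_mul_of_nonneg_right (hu x) hD
  have h5 := mul_le_mul_of_nonneg_left (h4.trans (h3.trans (add_le_add_right h2 _))) hκ.le
  nlinarith

/-- If all cells share almost the same factor, the density is almost of product form. -/
lemma integral_abs_sub_le_sum [Fintype I] {b : I → Y → ℝ} {b₀ : Y → ℝ} {u : X → ℝ}
    {k : X × Y → ℝ} {ι : X → I} {κ : ℝ} (hκ : 0 < κ) (hk0 : ∀ z, 0 ≤ k z) (hk : ∀ z, k z ≤ κ⁻¹)
    (hu0 : ∀ x, 0 ≤ u x) (hu : ∀ x, u x ≤ κ⁻¹) (hb : ∀ i, Integrable (b i) ν)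
    (hb₀ : Integrable b₀ ν) :
    ∫ z, |u z.1 * b (ι z.1) z.2 * k z - u z.1 * b₀ z.2 * k z| ∂(μ.prod ν)
      ≤ κ⁻¹ * κ⁻¹ * ∑ i, ∫ y, |b i y - b₀ y| ∂ν := by
  have hi : ∀ i, Integrable (fun y => |b i y - b₀ y|) ν := fun i => ((hb i).sub hb₀).abs
  have hS : Integrable (fun y => κ⁻¹ * κ⁻¹ * ∑ i, |b i y - b₀ y|) ν :=
    (integrable_finsetSum _ fun i _ => hi i).const_mul _
  rw [← integral_finsetSum _ fun i _ => hi i, ← integral_const_mul]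
  have e : ∫ y, κ⁻¹ * κ⁻¹ * ∑ i, |b i y - b₀ y| ∂ν
      = ∫ z, κ⁻¹ * κ⁻¹ * ∑ i, |b i z.2 - b₀ z.2| ∂(μ.prod ν) := by
    rw [integral_fun_snd (μ := μ) (ν := ν) (fun y => κ⁻¹ * κ⁻¹ * ∑ i, |b i y - b₀ y|)]
    simp
  rw [e]
  refine integral_mono_of_nonneg (ae_of_all _ fun z => abs_nonneg _) (hS.comp_snd μ)
    (ae_of_all _ fun z => ?_)
  have e2 : u z.1 * b (ι z.1) z.2 * k z - u z.1 * b₀ z.2 * k z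
      = u z.1 * k z * (b (ι z.1) z.2 - b₀ z.2) := by ring
  simp only
  rw [e2, abs_mul, abs_of_nonneg (mul_nonneg (hu0 _) (hk0 _))]
  refine mul_le_mul (mul_le_mul (hu _) (hk _) (hk0 _) (inv_pos.2 hκ).le) ?_ (abs_nonneg _)
    (by positivity)
  exact Finset.single_le_sum (f := fun i => |b i z.2 - b₀ z.2|) (fun i _ => abs_nonneg _)
    (Finset.mem_univ _)

/-- Rescaling an almost product density to have the correct second marginal is harmless. -/
lemma integral_abs_sub_le_of_marginal {q r : X × Y → ℝ} {b w : Y → ℝ}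
    (hq : Integrable q (μ.prod ν)) (hq1 : ∀ᵐ y ∂ν, ∫ x, q (x, y) ∂μ = 1)
    (hr0 : ∀ z, 0 ≤ r z) (hw : ∀ y, w y = ∫ x, r (x, y) ∂μ)
    (hw0 : ∀ y, 0 < w y)
    (hb : Integrable (fun z => r z * b z.2) (μ.prod ν))
    (hrw : Integrable (fun z => r z * (w z.2)⁻¹) (μ.prod ν)) :
    ∫ z, |q z - r z * (w z.2)⁻¹| ∂(μ.prod ν)
      ≤ 2 * ∫ z, |q z - r z * b z.2| ∂(μ.prod ν) := by
  have h1 : ∫ z, |r z * b z.2 - r z * (w z.2)⁻¹| ∂(μ.prod ν)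
      ≤ ∫ z, |q z - r z * b z.2| ∂(μ.prod ν) := by
    have hi1 : Integrable (fun z => |r z * b z.2 - r z * (w z.2)⁻¹|) (μ.prod ν) :=
      (hb.sub hrw).abs
    have hi2 : Integrable (fun z => |q z - r z * b z.2|) (μ.prod ν) := (hq.sub hb).abs
    rw [integral_prod_symm _ hi1, integral_prod_symm _ hi2]
    refine integral_mono_ae hi1.integral_prod_right hi2.integral_prod_right ?_
    filter_upwards [hq1, hq.prod_left_ae, hb.prod_left_ae] with y hy hqy hby
    have e : ∀ x, |r (x, y) * b y - r (x, y) * (w y)⁻¹| = r (x, y) * |b y - (w y)⁻¹| := by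
      intro x
      rw [← mul_sub, abs_mul, abs_of_nonneg (hr0 _)]
    simp only [e]
    rw [integral_mul_const, ← hw]
    have e2 : w y * |b y - (w y)⁻¹| = |∫ x, (q (x, y) - r (x, y) * b y) ∂μ| := by
      rw [integral_sub hqy hby, hy, integral_mul_const, ← hw]
      conv_lhs => rw [← abs_of_pos (hw0 y), ← abs_mul, abs_of_pos (hw0 y)]
      rw [mul_sub, mul_inv_cancel₀ (hw0 y).ne', abs_sub_comm]
    rw [e2]
    exact abs_integral_le_integral_abs
  have h2 : ∫ z, |q z - r z * (w z.2)⁻¹| ∂(μ.prod ν)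
      ≤ ∫ z, |q z - r z * b z.2| ∂(μ.prod ν)
        + ∫ z, |r z * b z.2 - r z * (w z.2)⁻¹| ∂(μ.prod ν) :=
    integral_abs_sub_triangle hq hb hrw
  linarith

lemma relEnt_le_integral_abs_sub {Z : Type*} [MeasurableSpace Z] {ρ : Measure Z}
    {p q : Z → ℝ} {B : ℝ} (hB : 0 < B) (hp : Integrable p ρ) (hq : Integrable q ρ)
    (hpB : ∀ z, 0 ≤ p z ∧ p z ≤ B) (hqB : ∀ z, B⁻¹ ≤ q z ∧ q z ≤ B) :
    relEnt ρ p q ≤ 2 * B ^ 2 * ∫ z, |p z - q z| ∂ρ := by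
  rw [← integral_const_mul]
  have hq0 : ∀ z, 0 ≤ q z := fun z => (inv_pos.2 hB).le.trans (hqB z).1
  exact integral_mono_of_nonneg
    (ae_of_all _ fun z => mul_nonneg (hq0 z) (phiKL_nonneg (div_nonneg (hpB z).1 (hq0 z))))
    ((hp.sub hq).abs.const_mul _)
    (ae_of_all _ fun z => mul_phiKL_div_le hB (hpB z).1 (hpB z).2 (hqB z).2 (hqB z).1)

end Estimates

section Limit

lemma exists_tendsto_integral_abs_sub {Z : Type*} [MeasurableSpace Z] {ρ : Measure Z}
    {p : ℕ → Z → ℝ} (hp : ∀ k, Integrable (p k) ρ)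
    (hC : ∀ δ > 0, ∃ N, ∀ k ≥ N, ∫ z, |p k z - p N z| ∂ρ < δ) :
    ∃ g : Z → ℝ, Measurable g ∧ Integrable g ρ ∧
      Tendsto (fun k => ∫ z, |p k z - g z| ∂ρ) atTop (𝓝 0) := by
  have hdist : ∀ {f g : Z → ℝ} (hf : Integrable f ρ) (hg : Integrable g ρ),
      dist (hf.toL1 f) (hg.toL1 g) = ∫ z, |f z - g z| ∂ρ := by
    intro f g hf hg
    rw [dist_eq_norm, ← Integrable.toL1_sub, L1.norm_of_fun_eq_integral_norm]
    rfl
  have hcau : CauchySeq fun k => (hp k).toL1 (p k) := by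
    rw [Metric.cauchySeq_iff']
    intro δ hδ
    obtain ⟨N, hN⟩ := hC δ hδ
    exact ⟨N, fun k hk => by rw [hdist]; exact hN k hk⟩
  obtain ⟨F, hF⟩ := cauchySeq_tendsto_of_complete hcau
  refine ⟨F, (Lp.stronglyMeasurable F).measurable, L1.integrable_coeFn F, ?_⟩
  have h := tendsto_iff_dist_tendsto_zero.1 hF
  refine h.congr fun k => ?_
  rw [← hdist (hp k) (L1.integrable_coeFn F), Integrable.toL1_coeFn]

lemma exists_subseq_tendsto_ae {Z : Type*} [MeasurableSpace Z] {ρ : Measure Z}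
    {p : ℕ → Z → ℝ} {g : Z → ℝ} (hp : ∀ k, Integrable (p k) ρ) (hg : Integrable g ρ)
    (h : Tendsto (fun k => ∫ z, |p k z - g z| ∂ρ) atTop (𝓝 0)) :
    ∃ ns : ℕ → ℕ, StrictMono ns ∧
      ∀ᵐ z ∂ρ, Tendsto (fun j => p (ns j) z) atTop (𝓝 (g z)) := by
  refine (tendstoInMeasure_of_tendsto_eLpNorm (p := 1) one_ne_zero
    (fun k => (hp k).aestronglyMeasurable) hg.aestronglyMeasurable ?_).exists_seq_tendsto_ae
  have h' := ENNReal.tendsto_ofReal h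
  rw [ENNReal.ofReal_zero] at h'
  refine h'.congr fun k => ?_
  rw [eLpNorm_one_eq_lintegral_enorm]
  exact ofReal_integral_norm_eq_lintegral_enorm ((hp k).sub hg)

lemma tendsto_integral_mul_of_tendsto_integral_abs_sub {Z ι : Type*} [MeasurableSpace Z]
    {ρ : Measure Z} {lf : Filter ι} {p : ι → Z → ℝ} {g f : Z → ℝ} (hp : ∀ k, Integrable (p k) ρ)
    (hg : Integrable g ρ) (hf : Measurable f) {C : ℝ} (hfC : ∀ z, |f z| ≤ C)
    (h : Tendsto (fun k => ∫ z, |p k z - g z| ∂ρ) lf (𝓝 0)) :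
    Tendsto (fun k => ∫ z, p k z * f z ∂ρ) lf (𝓝 (∫ z, g z * f z ∂ρ)) := by
  have hi : ∀ {w : Z → ℝ}, Integrable w ρ → Integrable (fun z => w z * f z) ρ := fun hw =>
    hw.mul_bdd hf.aestronglyMeasurable (ae_of_all _ hfC)
  rw [tendsto_iff_norm_sub_tendsto_zero]
  refine squeeze_zero (fun _ => norm_nonneg _) (fun k => ?_) (by simpa using h.const_mul C)
  rw [← integral_sub (hi (hp k)) (hi hg), ← integral_const_mul]
  refine (norm_integral_le_integral_norm _).trans
    (integral_mono_of_nonneg (ae_of_all _ fun z => norm_nonneg _)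
      (((hp k).sub hg).abs.const_mul C) (ae_of_all _ fun z => ?_))
  simp only
  rw [← sub_mul, norm_mul, mul_comm]
  exact mul_le_mul_of_nonneg_right (hfC z) (abs_nonneg _)

variable {X Y : Type*} [MeasurableSpace X] [MeasurableSpace Y]

/-- `p` is a density, of finite entropy, of a coupling of `μ` and `ν`. -/
structure IsCouplingDens (μ : Measure X) (ν : Measure Y) (p : X × Y → ℝ) : Prop where
  measurable : Measurable p
  nonneg : ∀ z, 0 ≤ p z
  integrable_phiKL : Integrable (fun z => phiKL (p z)) (μ.prod ν)
  isCoupling : IsCoupling μ ν (dens (μ.prod ν) p)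

lemma IsCouplingDens.integrable {μ : Measure X} {ν : Measure Y} [IsProbabilityMeasure μ]
    [SFinite ν] {p : X × Y → ℝ} (h : IsCouplingDens μ ν p) :
    Integrable p (μ.prod ν) := by
  have := h.isCoupling.isFiniteMeasure
  exact integrable_of_isFiniteMeasure_dens h.measurable h.nonneg

lemma IsCouplingDens.integral_eq_one {μ : Measure X} {ν : Measure Y} [IsProbabilityMeasure μ]
    [SFinite ν] {p : X × Y → ℝ} (h : IsCouplingDens μ ν p) :
    ∫ z, p z ∂(μ.prod ν) = 1 := by
  have h1 := integral_dens (ρ := μ.prod ν) h.measurable h.nonneg (fun _ => 1)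
  have h2 : (dens (μ.prod ν) p).real Set.univ = 1 := by
    rw [Measure.real, ← Set.preimage_univ (f := Prod.fst), ← Measure.map_apply measurable_fst
      MeasurableSet.univ, h.isCoupling.1]
    simp
  simpa [h2] using h1.symm

variable {μ : Measure X} {ν : Measure Y} [IsProbabilityMeasure μ] [IsProbabilityMeasure ν]

lemma isCoupling_dens_of_tendsto {p : ℕ → X × Y → ℝ} {g : X × Y → ℝ}
    (hp : ∀ k, IsCouplingDens μ ν (p k)) (hgm : Measurable g) (hg0 : ∀ z, 0 ≤ g z)
    (hg : Integrable g (μ.prod ν))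
    (h : Tendsto (fun k => ∫ z, |p k z - g z| ∂(μ.prod ν)) atTop (𝓝 0)) :
    IsCoupling μ ν (dens (μ.prod ν) g) := by
  have hfin : IsFiniteMeasure (dens (μ.prod ν) g) := isFiniteMeasure_withDensity_ofReal hg.2
  have hlim : ∀ s, MeasurableSet s → Tendsto (fun k => (dens (μ.prod ν) (p k)).real s) atTop
      (𝓝 ((dens (μ.prod ν) g).real s)) := by
    intro s hs
    have h1 := tendsto_integral_mul_of_tendsto_integral_abs_sub (f := s.indicator fun _ => 1)
      (C := 1) (fun k => (hp k).integrable) hg (measurable_const.indicator hs)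
      (fun z => by by_cases hz : z ∈ s <;> simp [hz]) h
    simp_rw [← integral_dens (hp _).measurable (hp _).nonneg, ← integral_dens hgm hg0,
      integral_indicator_const (1 : ℝ) hs, smul_eq_mul, mul_one] at h1
    exact h1
  constructor
  · refine Measure.ext fun s hs =>
      (ENNReal.toReal_eq_toReal_iff' (measure_ne_top _ _) (measure_ne_top _ _)).1 ?_
    change Measure.real _ s = μ.real s
    rw [map_measureReal_apply measurable_fst hs]
    refine tendsto_nhds_unique (hlim _ (measurable_fst hs)) ?_
    refine tendsto_const_nhds.congr fun k => ?_
    rw [← map_measureReal_apply measurable_fst hs, (hp k).isCoupling.1]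
  · refine Measure.ext fun s hs =>
      (ENNReal.toReal_eq_toReal_iff' (measure_ne_top _ _) (measure_ne_top _ _)).1 ?_
    change Measure.real _ s = ν.real s
    rw [map_measureReal_apply measurable_snd hs]
    refine tendsto_nhds_unique (hlim _ (measurable_snd hs)) ?_
    refine tendsto_const_nhds.congr fun k => ?_
    rw [← map_measureReal_apply measurable_snd hs, (hp k).isCoupling.2]

lemma exists_energy_eq_relEnt_add {c : X × Y → ℝ} (hc : Measurable c) {M : ℝ}
    (hcM : ∀ z, |c z| ≤ M) {ε : ℝ} (hε : 0 < ε) {u : X → ℝ} {v : Y → ℝ} {l L : ℝ}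
    (hu : Measurable u) (hv : Measurable v) (hl : 0 < l) (hul : ∀ x, l ≤ u x ∧ u x ≤ L)
    (hvl : ∀ y, l ≤ v y ∧ v y ≤ L)
    (hq : Integrable (fun z => u z.1 * v z.2 * Real.exp (-c z / ε)) (μ.prod ν)) :
    ∃ A : ℝ, ∀ p, IsCouplingDens μ ν p →
      Integrable (fun z => u z.1 * v z.2 * Real.exp (-c z / ε) *
        phiKL (p z / (u z.1 * v z.2 * Real.exp (-c z / ε)))) (μ.prod ν) ∧
      energy c ε (μ.prod ν) p
        = ε * relEnt (μ.prod ν) p (fun z => u z.1 * v z.2 * Real.exp (-c z / ε)) + A := by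
  have hlu := integrable_log_of_bounds (μ := μ) hu hl hul
  have hlv := integrable_log_of_bounds (μ := ν) hv hl hvl
  refine ⟨ε * (∫ x, Real.log (u x) ∂μ + ∫ y, Real.log (v y) ∂ν
    + ∫ z, (1 - u z.1 * v z.2 * Real.exp (-c z / ε)) ∂(μ.prod ν)), fun p hp => ?_⟩
  have := hp.isCoupling.isFiniteMeasure
  have h1 : Integrable (fun z : X × Y => Real.log (u z.1)) (dens (μ.prod ν) p) := by
    have := hlu; rw [← hp.isCoupling.1] at this; exact this.comp_measurable measurable_fst
  have h2 : Integrable (fun z : X × Y => Real.log (v z.2)) (dens (μ.prod ν) p) := by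
    have := hlv; rw [← hp.isCoupling.2] at this; exact this.comp_measurable measurable_snd
  have e1 : ∫ z : X × Y, Real.log (u z.1) ∂(dens (μ.prod ν) p) = ∫ x, Real.log (u x) ∂μ := by
    have hm : Measurable fun x => Real.log (u x) := Real.measurable_log.comp hu
    conv_rhs => rw [← hp.isCoupling.1]
    rw [integral_map measurable_fst.aemeasurable hm.aestronglyMeasurable]
  have e2 : ∫ z : X × Y, Real.log (v z.2) ∂(dens (μ.prod ν) p) = ∫ y, Real.log (v y) ∂ν := by
    have hm : Measurable fun y => Real.log (v y) := Real.measurable_log.comp hv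
    conv_rhs => rw [← hp.isCoupling.2]
    rw [integral_map measurable_snd.aemeasurable hm.aestronglyMeasurable]
  obtain ⟨h3, -, h4⟩ := energy_eq_of_dens (g := fun z : X × Y => u z.1 * v z.2)
    (L := fun z : X × Y => Real.log (u z.1) + Real.log (v z.2)) hc hcM hε hp.measurable hp.nonneg
    hp.integrable_phiKL hq (h1.add h2) (ae_of_all _ fun z => by
      have hu0 := hl.trans_le (hul z.1).1
      have hv0 := hl.trans_le (hvl z.2).1
      exact ⟨mul_pos hu0 hv0, (Real.log_mul hu0.ne' hv0.ne').symm⟩)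
  refine ⟨h3, ?_⟩
  rw [h4, integral_add h1 h2, e1, e2]
  ring

/-- A sequence with decreasing energy, which along a subsequence becomes asymptotically close to
positive densities `r` whose entropies differ from the energy by a constant, converges to the
minimizer. -/
lemma exists_limit_of_almost_scaling {c : X × Y → ℝ} (hc : Measurable c) {M : ℝ}
    (hcM : ∀ z, |c z| ≤ M) {ε : ℝ} (hε : 0 < ε) {B : ℝ} (hB : 0 < B)
    {p r : ℕ → X × Y → ℝ} {A : ℕ → ℝ} {n : ℕ → ℕ} (hn : Tendsto n atTop atTop)
    (hp : ∀ k, IsCouplingDens μ ν (p k))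
    (hmono : Antitone fun k => energy c ε (μ.prod ν) (p k))
    (hpB : ∀ m z, p (n m) z ≤ B) (hr : ∀ m, Measurable (r m))
    (hrB : ∀ m z, B⁻¹ ≤ r m z ∧ r m z ≤ B)
    (hA : ∀ m s, IsCouplingDens μ ν s →
      Integrable (fun z => r m z * phiKL (s z / r m z)) (μ.prod ν) ∧
      energy c ε (μ.prod ν) s = ε * relEnt (μ.prod ν) s (r m) + A m)
    (hlim : Tendsto (fun m => ∫ z, |p (n m) z - r m z| ∂(μ.prod ν)) atTop (𝓝 0)) :
    ∃ g, IsCouplingDens μ ν g ∧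
      (∀ s, IsCouplingDens μ ν s → energy c ε (μ.prod ν) g ≤ energy c ε (μ.prod ν) s) ∧
      Tendsto (fun k => ∫ z, |p k z - g z| ∂(μ.prod ν)) atTop (𝓝 0) := by
  have hr0 : ∀ m z, 0 < r m z := fun m z => (inv_pos.2 hB).trans_le (hrB m z).1
  have hri : ∀ m, Integrable (r m) (μ.prod ν) := fun m =>
    integrable_of_bounds (hr m) (fun z => (hrB m z).1) fun z => (hrB m z).2
  have hpi := fun k => (hp k).integrable
  set e : ℕ → ℝ := fun m => relEnt (μ.prod ν) (p (n m)) (r m) with he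
  have he0 : Tendsto e atTop (𝓝 0) := by
    refine squeeze_zero (fun m => relEnt_nonneg (hp _).nonneg fun z => (hr0 m z).le) (fun m => ?_)
      (by simpa using hlim.const_mul (2 * B ^ 2))
    exact relEnt_le_integral_abs_sub hB (hpi _) (hri m)
      (fun z => ⟨(hp _).nonneg z, hpB m z⟩) (hrB m)
  have hclose : ∀ m k, n m ≤ k →
      ∫ z, |p k z - r m z| ∂(μ.prod ν) ≤ (2 + B) * √(e m) := by
    intro m k hk
    have h1 := hmono hk
    simp only [(hA m _ (hp _)).2] at h1
    have h2 : relEnt (μ.prod ν) (p k) (r m) ≤ e m :=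
      le_of_mul_le_mul_left (by linarith) hε
    refine (integral_abs_sub_le (hp k).nonneg (fun z => (hr0 m z).le) (hpi k) (hri m)
      (ae_of_all _ fun z hz => absurd hz (hr0 m z).ne') (hA m _ (hp k)).1).trans ?_
    have h3 : ∫ z, r m z ∂(μ.prod ν) ≤ B := by
      have h4 := integral_mono (hri m) (integrable_const B) fun z => (hrB m z).2
      simpa using h4
    refine mul_le_mul ?_ (Real.sqrt_le_sqrt h2) (Real.sqrt_nonneg _) (by positivity)
    rw [(hp k).integral_eq_one]
    linarith
  have hδ : Tendsto (fun m => (2 + B) * √(e m)) atTop (𝓝 0) := by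
    have h1 := (he0.sqrt).const_mul (2 + B)
    simpa using h1
  obtain ⟨g, hgm, hgi, hg⟩ := exists_tendsto_integral_abs_sub hpi (by
    intro δ hδ0
    obtain ⟨m, hm⟩ := (hδ.eventually (gt_mem_nhds (half_pos hδ0))).exists
    refine ⟨n m, fun k hk => ?_⟩
    have h1 := hclose m k hk
    have h2 := hclose m (n m) le_rfl
    have h3 := integral_abs_sub_triangle (hpi k) (hri m) (hpi (n m))
    simp_rw [abs_sub_comm (r m _)] at h3
    linarith)
  obtain ⟨ns, hns, hae⟩ := exists_subseq_tendsto_ae (fun m => hpi (n m)) hgi (hg.comp hn)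
  set h : X × Y → ℝ := fun z => max 0 (min B (g z)) with hh
  have hgh : g =ᵐ[μ.prod ν] h := by
    filter_upwards [hae] with z hz
    have h1 := ge_of_tendsto' hz fun j => (hp _).nonneg z
    have h2 := le_of_tendsto' hz fun j => hpB _ z
    simp only [hh, min_eq_right h2, max_eq_right h1]
  have hhm : Measurable h := measurable_const.max (measurable_const.min hgm)
  have hh0 : ∀ z, 0 ≤ h z := fun z => le_max_left _ _
  have hhB : ∀ z, h z ≤ B := fun z => max_le hB.le (min_le_left _ _)
  have hhi : Integrable h (μ.prod ν) := integrable_of_bounds hhm hh0 hhB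
  have hlimh : Tendsto (fun k => ∫ z, |p k z - h z| ∂(μ.prod ν)) atTop (𝓝 0) := by
    refine hg.congr fun k => integral_congr_ae ?_
    filter_upwards [hgh] with z hz
    rw [hz]
  have hhd : IsCouplingDens μ ν h := ⟨hhm, hh0, integrable_phiKL_comp hhm hh0 hhB,
    isCoupling_dens_of_tendsto hp hhm hh0 hhi hlimh⟩
  have hE : Tendsto (fun j => energy c ε (μ.prod ν) (p (n (ns j)))) atTop
      (𝓝 (energy c ε (μ.prod ν) h)) := by
    refine Tendsto.add ?_ (Tendsto.const_mul _ ?_)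
    · have h1 := (tendsto_integral_mul_of_tendsto_integral_abs_sub hpi hhi hc hcM hlimh).comp
        (hn.comp hns.tendsto_atTop)
      simp_rw [mul_comm (c _)]
      exact h1
    · refine tendsto_integral_of_dominated_convergence (fun _ => (B + 1) ^ 2)
        (fun j => (hp _).integrable_phiKL.aestronglyMeasurable) (integrable_const _)
        (fun j => ae_of_all _ fun z => ?_) ?_
      · have h1 := (hp (n (ns j))).nonneg z
        have h2 := hpB (ns j) z
        rw [Real.norm_eq_abs, abs_of_nonneg (phiKL_nonneg h1)]
        exact (phiKL_le_sq h1).trans (sq_le_sq' (by linarith) (by linarith))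
      · filter_upwards [hae, hgh] with z hz hzh
        rw [← hzh]
        exact (continuous_phiKL.tendsto _).comp hz
  refine ⟨h, hhd, fun s hs => ?_, hlimh⟩
  have h1 := hE.sub ((he0.comp hns.tendsto_atTop).const_mul ε)
  rw [mul_zero, sub_zero] at h1
  refine le_of_tendsto' h1 fun j => ?_
  have h2 := (hA (ns j) _ (hp (n (ns j)))).2
  have h3 := (hA (ns j) s hs).2
  have h4 := mul_nonneg hε.le (relEnt_nonneg (ρ := μ.prod ν) hs.nonneg fun z => (hr0 (ns j) z).le)
  simp only [Function.comp, he]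
  linarith

end Limit

section Scaling

variable {X Y I : Type*} [MeasurableSpace X] [MeasurableSpace Y]

lemma tendsto_integral_abs_sub_of_reflTransGen {ν : Measure Y} {a b : ℕ → I → Y → ℝ}
    {r s : I → I → Prop} (ha : ∀ m i, Integrable (a m i) ν) (hb : ∀ m i, Integrable (b m i) ν)
    (har : ∀ m i j, r i j → a m i = a m j) (hbs : ∀ m i j, s i j → b m i = b m j)
    (hab : ∀ i, Tendsto (fun m => ∫ y, |a m i y - b m i y| ∂ν) atTop (𝓝 0)) {i j : I}
    (hij : Relation.ReflTransGen (fun i j => r i j ∨ s i j) i j) :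
    Tendsto (fun m => ∫ y, |a m j y - a m i y| ∂ν) atTop (𝓝 0) := by
  induction hij with
  | refl => simp
  | @tail j k _ hjk ih =>
    rcases hjk with hjk | hjk
    · simpa only [har _ _ _ hjk] using ih
    · have h := ((hab k).add (hab j)).add ih
      simp only [add_zero] at h
      refine squeeze_zero (fun m => integral_nonneg fun y => abs_nonneg _) (fun m => ?_) h
      have h1 := integral_abs_sub_triangle (ha m k) (hb m k) (ha m i)
      have h2 := integral_abs_sub_triangle (hb m k) (ha m j) (ha m i)
      have h3 : ∫ y, |b m k y - a m j y| ∂ν = ∫ y, |a m j y - b m j y| ∂ν := by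
        rw [hbs m j k hjk]
        simp_rw [abs_sub_comm]
      linarith

variable {μ : Measure X} {ν : Measure Y} [IsProbabilityMeasure μ] [IsProbabilityMeasure ν]

lemma IsCouplingDens.integral_eq_one_ae {q : X × Y → ℝ} (hq : IsCouplingDens μ ν q) {B : ℝ}
    (hqB : ∀ z, q z ≤ B) : ∀ᵐ y ∂ν, ∫ x, q (x, y) ∂μ = 1 := by
  have h := hq.isCoupling.2
  rw [map_snd_dens hq.measurable hq.nonneg hqB] at h
  have h0 : ∀ y, 0 ≤ ∫ x, q (x, y) ∂μ := fun y => integral_nonneg fun x => hq.nonneg _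
  have hm : Measurable fun y => ∫ x, q (x, y) ∂μ :=
    (hq.measurable.stronglyMeasurable.integral_prod_left' (μ := μ)).measurable
  have h1 : ν.withDensity (fun y => ENNReal.ofReal (∫ x, q (x, y) ∂μ)) = ν.withDensity 1 := by
    rw [withDensity_one]; exact h
  filter_upwards [(withDensity_eq_iff_of_sigmaFinite hm.ennreal_ofReal.aemeasurable
    measurable_one.aemeasurable).1 h1] with y hy
  simpa using hy

/-- A density with factors which almost agree on all cells is close to a positive density of the
form `u(x) v(y) exp(-c(x,y)/ε)`. -/
lemma exists_scaling_close [Fintype I] {c : X × Y → ℝ} (hc : Measurable c) {M : ℝ}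
    (hcM : ∀ z, |c z| ≤ M) {ε : ℝ} (hε : 0 < ε) {κ : ℝ} (hκ : 0 < κ)
    (hk1 : ∀ z, κ ≤ Real.exp (-c z / ε)) (hk2 : ∀ z, Real.exp (-c z / ε) ≤ κ⁻¹)
    {B C : ℝ} (hB : κ⁻¹ ^ 4 ≤ B) {u : X → ℝ} {b : I → Y → ℝ} {ι : X → I} {q : X × Y → ℝ}
    (hq : q = fun z => u z.1 * b (ι z.1) z.2 * Real.exp (-c z / ε))
    (hu : Measurable u) (hb : ∀ i, Measurable (b i)) (hub : ∀ x, κ ≤ u x ∧ u x ≤ κ⁻¹)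
    (hbC : ∀ i y, 0 ≤ b i y ∧ b i y ≤ C) (hqd : IsCouplingDens μ ν q) (hqB : ∀ z, q z ≤ B)
    (i₀ : I) :
    ∃ (r : X × Y → ℝ) (A : ℝ), Measurable r ∧ (∀ z, B⁻¹ ≤ r z ∧ r z ≤ B) ∧
      (∀ s, IsCouplingDens μ ν s →
        Integrable (fun z => r z * phiKL (s z / r z)) (μ.prod ν) ∧
        energy c ε (μ.prod ν) s = ε * relEnt (μ.prod ν) s r + A) ∧
      ∫ z, |q z - r z| ∂(μ.prod ν) ≤ 2 * (κ⁻¹ * κ⁻¹ * ∑ i, ∫ y, |b i y - b i₀ y| ∂ν) := by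
  have hexp : Measurable fun z => Real.exp (-c z / ε) :=
    Real.measurable_exp.comp (hc.neg.div_const ε)
  set t : X × Y → ℝ := fun z => u z.1 * Real.exp (-c z / ε) with ht
  have htm : Measurable t := (hu.comp measurable_fst).mul hexp
  have hκ2 : 0 < κ ^ 2 := by positivity
  have htb : ∀ z, κ ^ 2 ≤ t z ∧ t z ≤ (κ ^ 2)⁻¹ := by
    intro z
    rw [pow_two, mul_inv]
    exact ⟨mul_le_mul (hub _).1 (hk1 z) hκ.le (hκ.le.trans (hub _).1),
      mul_le_mul (hub _).2 (hk2 z) (Real.exp_pos _).le (inv_pos.2 hκ).le⟩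
  have ht0 : ∀ z, 0 < t z := fun z => hκ2.trans_le (htb z).1
  have hti : Integrable t (μ.prod ν) :=
    integrable_of_bounds htm (fun z => (htb z).1) fun z => (htb z).2
  set w : Y → ℝ := fun y => ∫ x, t (x, y) ∂μ with hw
  have hwm : Measurable w := (htm.stronglyMeasurable.integral_prod_left' (μ := μ)).measurable
  have hwb : ∀ y, κ ^ 2 ≤ w y ∧ w y ≤ (κ ^ 2)⁻¹ := by
    intro y
    have hm : Measurable fun x => t (x, y) := htm.comp measurable_prodMk_right
    have hi : Integrable (fun x => t (x, y)) μ :=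
      integrable_of_bounds hm (fun x => (htb _).1) fun x => (htb _).2
    have h1 := integral_mono (integrable_const (κ ^ 2)) hi fun x => (htb (x, y)).1
    have h2 := integral_mono hi (integrable_const (κ ^ 2)⁻¹) fun x => (htb (x, y)).2
    simp only [integral_const, probReal_univ, one_smul] at h1 h2
    exact ⟨h1, h2⟩
  have hw0 : ∀ y, 0 < w y := fun y => hκ2.trans_le (hwb y).1
  have hwib : ∀ y, κ ^ 2 ≤ (w y)⁻¹ ∧ (w y)⁻¹ ≤ (κ ^ 2)⁻¹ := fun y =>
    ⟨by rw [← inv_inv (κ ^ 2)]; exact inv_anti₀ (hw0 y) (hwb y).2,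
      inv_anti₀ hκ2 (hwb y).1⟩
  set r : X × Y → ℝ := fun z => u z.1 * (w z.2)⁻¹ * Real.exp (-c z / ε) with hr
  have hrt : ∀ z, r z = t z * (w z.2)⁻¹ := fun z => by simp only [hr, ht]; ring
  have hrm : Measurable r :=
    ((hu.comp measurable_fst).mul (hwm.comp measurable_snd).inv).mul hexp
  have hκ4 : κ⁻¹ ^ 4 = (κ ^ 2)⁻¹ * (κ ^ 2)⁻¹ := by rw [inv_pow, ← mul_inv]; ring
  have hrB : ∀ z, B⁻¹ ≤ r z ∧ r z ≤ B := by
    intro z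
    rw [hrt]
    constructor
    · calc B⁻¹ ≤ (κ⁻¹ ^ 4)⁻¹ := inv_anti₀ (by positivity) hB
        _ = κ ^ 2 * κ ^ 2 := by rw [hκ4, mul_inv, inv_inv]
        _ ≤ _ := mul_le_mul (htb z).1 (hwib _).1 hκ2.le (ht0 z).le
    · refine le_trans ?_ hB
      rw [hκ4]
      exact mul_le_mul (htb z).2 (hwib _).2 (inv_pos.2 (hw0 _)).le (inv_pos.2 hκ2).le
  have hri : Integrable r (μ.prod ν) :=
    integrable_of_bounds hrm (fun z => (hrB z).1) fun z => (hrB z).2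
  obtain ⟨A, hA⟩ := exists_energy_eq_relEnt_add (μ := μ) (ν := ν) hc hcM hε hu hwm.inv
    (l := min κ (κ ^ 2)) (L := max κ⁻¹ (κ ^ 2)⁻¹) (lt_min hκ hκ2)
    (fun x => ⟨(min_le_left _ _).trans (hub x).1, (hub x).2.trans (le_max_left _ _)⟩)
    (fun y => ⟨(min_le_right _ _).trans (hwib y).1, (hwib y).2.trans (le_max_right _ _)⟩) hri
  refine ⟨r, A, hrm, hrB, hA, ?_⟩
  have hbi : ∀ i, Integrable (b i) ν := fun i =>
    integrable_of_bounds (hb i) (fun y => (hbC i y).1) fun y => (hbC i y).2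
  have htb' : Integrable (fun z => t z * b i₀ z.2) (μ.prod ν) :=
    ((hbi i₀).comp_snd μ).bdd_mul htm.aestronglyMeasurable (c := (κ ^ 2)⁻¹)
      (ae_of_all _ fun z => by rw [Real.norm_eq_abs, abs_of_pos (ht0 z)]; exact (htb z).2)
  have h1 := integral_abs_sub_le_of_marginal (b := b i₀) (w := w) hqd.integrable
    (hqd.integral_eq_one_ae hqB) (fun z => (ht0 z).le) (fun y => by rw [hw]) hw0 htb'
    (by simp_rw [← hrt]; exact hri)
  simp_rw [← hrt] at h1
  refine h1.trans (mul_le_mul_of_nonneg_left ?_ zero_le_two)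
  have h2 := integral_abs_sub_le_sum (μ := μ) (ν := ν) (ι := ι) (b₀ := b i₀) hκ
    (fun z => (Real.exp_pos (-c z / ε)).le) hk2 (fun x => hκ.le.trans (hub x).1)
    (fun x => (hub x).2) hbi (hbi i₀)
  have e : ∀ z, |q z - t z * b i₀ z.2| = |u z.1 * b (ι z.1) z.2 * Real.exp (-c z / ε)
      - u z.1 * b i₀ z.2 * Real.exp (-c z / ε)| := fun z => by
    rw [hq]
    simp only [ht]
    ring_nf
  simp_rw [e]
  exact h2

end Scaling

section Cells

variable {X Y I : Type*} [MeasurableSpace X] [MeasurableSpace Y]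

lemma exists_label [Fintype I] [Nonempty X] {μ : Measure X} {Xpart : I → Set X}
    (hmeas : ∀ i, MeasurableSet (Xpart i)) (hcover : ⋃ i, Xpart i = Set.univ)
    (hdisj : ∀ i j, i ≠ j → μ (Xpart i ∩ Xpart j) = 0) :
    ∃ ι : X → I, (∀ i, MeasurableSet (ι ⁻¹' {i})) ∧ ∀ i, ι ⁻¹' {i} =ᵐ[μ] Xpart i := by
  classical
  have hx : ∀ x, ∃ i, x ∈ Xpart i := fun x => by
    simpa using (hcover.symm ▸ Set.mem_univ x : x ∈ ⋃ i, Xpart i)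
  have : Nonempty I := ⟨(hx (Classical.arbitrary X)).choose⟩
  obtain ⟨f, hf⟩ := exists_surjective_nat I
  have hn : ∀ x, ∃ n, x ∈ Xpart (f n) := fun x => by
    obtain ⟨i, hi⟩ := hx x
    obtain ⟨n, rfl⟩ := hf i
    exact ⟨n, hi⟩
  have hfind : Measurable fun x => Nat.find (hn x) := measurable_find hn fun n => hmeas (f n)
  refine ⟨fun x => f (Nat.find (hn x)), fun i => ?_, fun i => ?_⟩
  · exact hfind (MeasurableSet.of_discrete (s := f ⁻¹' {i}))
  · have hsub : (fun x => f (Nat.find (hn x))) ⁻¹' {i} ⊆ Xpart i := by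
      rintro x rfl
      exact Nat.find_spec (hn x)
    have hnull : μ (⋃ j, ⋃ _ : j ≠ i, Xpart j ∩ Xpart i) = 0 :=
      measure_iUnion_null fun j => measure_iUnion_null fun h => hdisj j i h
    refine Filter.EventuallyLE.antisymm hsub.eventuallyLE ?_
    rw [ae_le_set]
    refine measure_mono_null ?_ hnull
    rintro x ⟨hxi, hxn⟩
    simp only [Set.mem_iUnion]
    exact ⟨_, hxn, Nat.find_spec (hn x), hxi⟩

lemma CellSolve.congr_set {c : X × Y → ℝ} {ε : ℝ} {μ : Measure X} {ν : Measure Y}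
    {π π' : Measure (X × Y)} {s t : Set X} (hπ : IsCoupling μ ν π) (hπ' : IsCoupling μ ν π')
    (hst : s =ᵐ[μ] t) (h : CellSolve c ε ν π π' s) : CellSolve c ε ν π π' t := by
  have hr : ∀ {ρ : Measure (X × Y)}, IsCoupling μ ν ρ →
      ρ.restrict (s ×ˢ Set.univ) = ρ.restrict (t ×ˢ Set.univ) := by
    intro ρ hρ
    have hm : MeasurePreserving Prod.fst ρ μ := ⟨measurable_fst, hρ.1⟩
    have := hm.quasiMeasurePreserving.preimage_ae_eq hst
    rw [Set.prod_univ, Set.prod_univ]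
    exact Measure.restrict_congr_set this
  unfold CellSolve at h ⊢
  rwa [← hr hπ, ← hr hπ']

lemma reflTransGen_of_connected [DecidableEq I] {JA JB : Finset (Finset I)}
    {CA CB : I → Finset I} (hCA : ∀ i, CA i ∈ JA) (hA : ∀ J ∈ JA, ∀ i, CA i = J ↔ i ∈ J)
    (hB : ∀ J ∈ JB, ∀ i, CB i = J ↔ i ∈ J)
    (hconn : ∀ J ∈ JA ∪ JB, ∀ J' ∈ JA ∪ JB,
      Relation.ReflTransGen
        (fun K K' : Finset I => K ∈ JA ∪ JB ∧ K' ∈ JA ∪ JB ∧ (K ∩ K').Nonempty) J J')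
    (i j : I) :
    Relation.ReflTransGen (fun i j => CA i = CA j ∨ CB i = CB j) i j := by
  have hstep : ∀ K ∈ JA ∪ JB, ∀ a ∈ K, ∀ b ∈ K, CA a = CA b ∨ CB a = CB b := by
    intro K hK a ha b hb
    rcases Finset.mem_union.1 hK with h | h
    · exact Or.inl (((hA K h a).2 ha).trans ((hA K h b).2 hb).symm)
    · exact Or.inr (((hB K h a).2 ha).trans ((hB K h b).2 hb).symm)
  have hmem : ∀ i, CA i ∈ JA ∪ JB := fun i => Finset.mem_union_left _ (hCA i)
  have hself : ∀ i, i ∈ CA i := fun i => (hA _ (hCA i) i).1 rfl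
  have key : ∀ K, Relation.ReflTransGen
      (fun K K' : Finset I => K ∈ JA ∪ JB ∧ K' ∈ JA ∪ JB ∧ (K ∩ K').Nonempty) (CA i) K →
      ∀ a ∈ K, Relation.ReflTransGen (fun i j => CA i = CA j ∨ CB i = CB j) i a := by
    intro K hK
    induction hK with
    | refl => exact fun a ha => .single (hstep _ (hmem i) _ (hself i) _ ha)
    | tail _ h ih =>
      obtain ⟨_, hK', b, hb⟩ := h
      rw [Finset.mem_inter] at hb
      exact fun a ha => (ih b hb.1).tail (hstep _ hK' _ hb.2 _ ha)
  exact key _ (hconn _ (hmem i) _ (hmem j)) j (hself j)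

/-- `π'` has the density `q(x,y) = u(x) b_i(y) exp(-c(x,y)/ε)` on the cell with label `i`, with
bounds on all factors, and `π'` satisfies the Pythagorean identity with respect to `π`. -/
structure IsStepDensity (c : X × Y → ℝ) (ε : ℝ) (μ : Measure X) (ν : Measure Y) (κ m₀ : ℝ)
    (ι : X → I) (π π' : Measure (X × Y)) (u : X → ℝ) (b : I → Y → ℝ) (q : X × Y → ℝ) :
    Prop where
  eq : q = fun z => u z.1 * b (ι z.1) z.2 * Real.exp (-c z / ε)
  measurable_u : Measurable u
  measurable_b : ∀ i, Measurable (b i)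
  u_mem : ∀ x, κ ≤ u x ∧ u x ≤ κ⁻¹
  b_mem : ∀ i y, 0 ≤ b i y ∧ b i y ≤ (κ ^ 2 * m₀)⁻¹
  integral_b : ∀ i, ∫ y, b i y ∂ν = 1
  measurable : Measurable q
  mem : ∀ z, 0 ≤ q z ∧ q z ≤ κ⁻¹ * (κ ^ 2 * m₀)⁻¹ * κ⁻¹
  dens_eq : π' = dens (μ.prod ν) q
  pythagoras : ∀ p : X × Y → ℝ, Measurable p → (∀ z, 0 ≤ p z) →
    Integrable (fun z => phiKL (p z)) (μ.prod ν) → π = dens (μ.prod ν) p →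
    Integrable (fun z => q z * phiKL (p z / q z)) (μ.prod ν) ∧
    (∀ᵐ z ∂(μ.prod ν), q z = 0 → p z = 0) ∧
    energy c ε (μ.prod ν) p = energy c ε (μ.prod ν) q + ε * relEnt (μ.prod ν) p q

lemma exists_isStepDensity [Fintype I] {μ : Measure X} {ν : Measure Y} [IsFiniteMeasure μ]
    [IsFiniteMeasure ν] {c : X × Y → ℝ} (hc : Measurable c) {M : ℝ} (hcM : ∀ z, |c z| ≤ M)
    {ε : ℝ} (hε : 0 < ε) {κ : ℝ} (hκ : 0 < κ) (hκ1 : κ ≤ 1)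
    (hk1 : ∀ z, κ ≤ Real.exp (-c z / ε)) (hk2 : ∀ z, Real.exp (-c z / ε) ≤ κ⁻¹)
    {π π' : Measure (X × Y)} (hπ : IsCoupling μ ν π) (hπ' : IsCoupling μ ν π')
    {Xpart : I → Set X} {ι : X → I} (hι : ∀ i, MeasurableSet (ι ⁻¹' {i}))
    (hae : ∀ i, ι ⁻¹' {i} =ᵐ[μ] Xpart i) {m₀ : ℝ} (hm₀ : 0 < m₀)
    (hm : ∀ i, m₀ ≤ μ.real (Xpart i)) {𝒥 : Finset (Finset I)} {C : I → Finset I}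
    (hC : ∀ i, C i ∈ 𝒥) (hC' : ∀ J ∈ 𝒥, ∀ i, C i = J ↔ i ∈ J)
    (hcell : ∀ J ∈ 𝒥, CellSolve c ε ν π π' (⋃ i ∈ J, Xpart i)) :
    ∃ u b q, IsStepDensity c ε μ ν κ m₀ ι π π' u b q ∧ ∀ i j, C i = C j → b i = b j := by
  let _ : MeasurableSpace (Finset I) := ⊤
  set l : X → Finset I := fun x => C (ι x) with hl
  have hpre : ∀ J, l ⁻¹' {J} = ⋃ i, ⋃ _ : C i = J, ι ⁻¹' {i} := by
    intro J; ext x; simp [hl]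
  have hmass : ∀ i, m₀ ≤ μ.real (l ⁻¹' {C i}) := by
    intro i
    refine (hm i).trans ?_
    rw [← measureReal_congr (hae i)]
    exact measureReal_mono fun x (hx : ι x = i) => by
      rw [Set.mem_preimage, Set.mem_singleton_iff, hl, ← hx]
  have hlm : Measurable l := measurable_to_countable' fun J => by
    rw [hpre]
    exact MeasurableSet.iUnion fun i => MeasurableSet.iUnion fun _ => hι i
  have hne : ∀ J, (∃ i, C i = J) ∨ μ (l ⁻¹' {J}) = 0 := by
    intro J
    by_cases h : ∃ i, C i = J
    · exact Or.inl h
    · right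
      have : l ⁻¹' {J} = ∅ := by
        ext x
        simp only [Set.mem_preimage, Set.mem_singleton_iff, Set.mem_empty_iff_false, iff_false]
        exact fun hx => h ⟨_, hx⟩
      rw [this, measure_empty]
  have hset : ∀ i, l ⁻¹' {C i} =ᵐ[μ] (⋃ j ∈ C i, Xpart j : Set X) := by
    intro i
    have : l ⁻¹' {C i} = ⋃ j ∈ C i, ι ⁻¹' {j} := by
      ext x; simp [hl, hC' _ (hC i)]
    rw [this]
    exact Filter.EventuallyEq.countable_bUnion (Finset.countable_toSet (C i)) fun j _ => hae j
  obtain ⟨u, b, q, h1, h2, h3, h4, h5, h6, h7, h8, h9, h10⟩ := exists_step_density hc hcM hε hκ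
    hκ1 hk1 hk2 hπ hπ' hlm hm₀
    (fun J => (hne J).symm.imp_right (by rintro ⟨i, rfl⟩; exact hmass i))
    (fun J hJ => by
      rcases hne J with ⟨i, rfl⟩ | h0
      · exact (hcell _ (hC i)).congr_set hπ hπ' (hset i).symm
      · rw [measureReal_def, h0, ENNReal.toReal_zero] at hJ
        exact absurd hm₀ hJ.not_gt)
  exact ⟨u, fun i => b (C i), q, ⟨h1, h2, fun i => h3 _, h4, fun i => h5 _,
    fun i => h6 _ (hmass i), h7, h8, h9, h10⟩, fun i j h => by simp only [h]⟩

variable {μ : Measure X} {ν : Measure Y} {c : X × Y → ℝ} {ε κ m₀ : ℝ} {ι : X → I}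
  {π π' : Measure (X × Y)} {u : X → ℝ} {b : I → Y → ℝ} {q : X × Y → ℝ}

lemma IsStepDensity.isCouplingDens [IsFiniteMeasure μ] [IsFiniteMeasure ν]
    (h : IsStepDensity c ε μ ν κ m₀ ι π π' u b q) (hπ' : IsCoupling μ ν π') :
    IsCouplingDens μ ν q :=
  ⟨h.measurable, fun z => (h.mem z).1,
    integrable_phiKL_comp h.measurable (fun z => (h.mem z).1) fun z => (h.mem z).2,
    h.dens_eq ▸ hπ'⟩

lemma IsStepDensity.integrable_b [IsFiniteMeasure ν]
    (h : IsStepDensity c ε μ ν κ m₀ ι π π' u b q) (i : I) : Integrable (b i) ν :=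
  integrable_of_bounds (h.measurable_b i) (fun y => (h.b_mem i y).1) fun y => (h.b_mem i y).2

end Cells

section Alternating

variable {X Y I : Type*} [MeasurableSpace X] [MeasurableSpace Y]
  {μ : Measure X} {ν : Measure Y} [IsProbabilityMeasure μ] [IsProbabilityMeasure ν]

lemma IsCouplingDens.neg_le_energy {p : X × Y → ℝ} (hp : IsCouplingDens μ ν p) {c : X × Y → ℝ}
    (hc : Measurable c) {M : ℝ} (hcM : ∀ z, |c z| ≤ M) {ε : ℝ} (hε : 0 < ε) :
    -M ≤ energy c ε (μ.prod ν) p := by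
  have hi : Integrable (fun z => c z * p z) (μ.prod ν) :=
    hp.integrable.bdd_mul hc.aestronglyMeasurable (ae_of_all _ hcM)
  have h1 : ∫ z, -M * p z ∂(μ.prod ν) ≤ ∫ z, c z * p z ∂(μ.prod ν) :=
    integral_mono (hp.integrable.const_mul _) hi fun z =>
      mul_le_mul_of_nonneg_right (neg_le_of_abs_le (hcM z)) (hp.nonneg z)
  rw [integral_const_mul, hp.integral_eq_one, mul_one] at h1
  have h2 : 0 ≤ ∫ z, phiKL (p z) ∂(μ.prod ν) :=
    integral_nonneg fun z => phiKL_nonneg (hp.nonneg z)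
  exact le_add_of_le_of_nonneg h1 (mul_nonneg hε.le h2)

lemma exists_limit_of_alternating [Fintype I] [Nonempty I] {c : X × Y → ℝ} (hc : Measurable c)
    {M : ℝ} (hcM : ∀ z, |c z| ≤ M) {ε : ℝ} (hε : 0 < ε) {κ : ℝ} (hκ : 0 < κ)
    (hk1 : ∀ z, κ ≤ Real.exp (-c z / ε)) (hk2 : ∀ z, Real.exp (-c z / ε) ≤ κ⁻¹)
    {ι : X → I} (hι : ∀ i, MeasurableSet (ι ⁻¹' {i})) {m₀ : ℝ} (hm₀ : 0 < m₀)
    (hm : ∀ i, m₀ ≤ μ.real (ι ⁻¹' {i})) {π : ℕ → Measure (X × Y)} {p : ℕ → X × Y → ℝ}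
    {uA uB : ℕ → X → ℝ} {bA bB : ℕ → I → Y → ℝ}
    (hA : ∀ m, IsStepDensity c ε μ ν κ m₀ ι (π (3 * m)) (π (3 * m + 1)) (uA m) (bA m) (p (3 * m)))
    (hB : ∀ m, IsStepDensity c ε μ ν κ m₀ ι (π (3 * m + 1)) (π (3 * m + 2)) (uB m) (bB m)
      (p (3 * m + 1)))
    (hp : ∀ k, IsCouplingDens μ ν (p k)) (hπ : ∀ k, π (k + 1) = dens (μ.prod ν) (p k))
    (hF : ∀ m, energy c ε (μ.prod ν) (p (3 * m + 2)) ≤ energy c ε (μ.prod ν) (p (3 * m + 1)))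
    {r s : I → I → Prop} (hr : ∀ m i j, r i j → bA m i = bA m j)
    (hs : ∀ m i j, s i j → bB m i = bB m j)
    (hrs : ∀ i j, Relation.ReflTransGen (fun i j => r i j ∨ s i j) i j) :
    ∃ g, IsCouplingDens μ ν g ∧
      (∀ s, IsCouplingDens μ ν s → energy c ε (μ.prod ν) g ≤ energy c ε (μ.prod ν) s) ∧
      Tendsto (fun k => ∫ z, |p k z - g z| ∂(μ.prod ν)) atTop (𝓝 0) := by
  have hpA := fun m => (hA (m + 1)).pythagoras _ (hp (3 * m + 2)).measurable
    (hp (3 * m + 2)).nonneg (hp (3 * m + 2)).integrable_phiKL (hπ (3 * m + 2))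
  have hpB := fun m => (hB m).pythagoras _ (hp (3 * m)).measurable
    (hp (3 * m)).nonneg (hp (3 * m)).integrable_phiKL (hπ (3 * m))
  have hD : ∀ k l, 0 ≤ ε * relEnt (μ.prod ν) (p k) (p l) := fun k l =>
    mul_nonneg hε.le (relEnt_nonneg (hp k).nonneg (hp l).nonneg)
  have hmono : Antitone fun k => energy c ε (μ.prod ν) (p k) := by
    refine antitone_nat_of_succ_le fun k => ?_
    obtain ⟨m, h | h | h⟩ : ∃ m, k = 3 * m ∨ k = 3 * m + 1 ∨ k = 3 * m + 2 := ⟨k / 3, by omega⟩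
    · subst h
      rw [(hpB m).2.2]
      exact le_add_of_nonneg_right (hD _ _)
    · subst h
      exact hF m
    · subst h
      have h := (hpA m).2.2
      rw [h]
      exact le_add_of_nonneg_right (hD _ _)
  have hE := tendsto_atTop_ciInf hmono
    ⟨-M, by rintro _ ⟨k, rfl⟩; exact (hp k).neg_le_energy hc hcM hε⟩
  have hn : Tendsto (fun m : ℕ => 3 * m) atTop atTop :=
    tendsto_id.const_mul_atTop' (by norm_num : 0 < 3)
  have hn' : Tendsto (fun m : ℕ => 3 * m + 1) atTop atTop := (tendsto_add_atTop_nat 1).comp hn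
  have hrel : Tendsto (fun m => relEnt (μ.prod ν) (p (3 * m)) (p (3 * m + 1))) atTop (𝓝 0) := by
    have h := ((hE.comp hn).sub (hE.comp hn')).div_const ε
    rw [sub_self, zero_div] at h
    refine h.congr fun m => ?_
    have := (hpB m).2.2
    simp only [Function.comp_apply]
    rw [this]
    field_simp
    ring
  have hAB : Tendsto (fun m => ∫ z, |p (3 * m) z - p (3 * m + 1) z| ∂(μ.prod ν)) atTop (𝓝 0) := by
    have h := (hrel.sqrt).const_mul 3
    rw [Real.sqrt_zero, mul_zero] at h
    refine squeeze_zero (fun m => integral_nonneg fun z => abs_nonneg _) (fun m => ?_) h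
    have h := integral_abs_sub_le (hp (3 * m)).nonneg (hp (3 * m + 1)).nonneg
      (hp (3 * m)).integrable (hp (3 * m + 1)).integrable (hpB m).2.1 (hpB m).1
    rw [(hp _).integral_eq_one, (hp _).integral_eq_one] at h
    norm_num at h
    exact h
  have hb : ∀ i, Tendsto (fun m => ∫ y, |bA m i y - bB m i y| ∂ν) atTop (𝓝 0) := by
    intro i
    have hpos : 0 < m₀ * (κ ^ 2 / 2) := by positivity
    refine squeeze_zero (fun m => integral_nonneg fun y => abs_nonneg _) (fun m => ?_)
      (by simpa using hAB.const_mul (m₀ * (κ ^ 2 / 2))⁻¹)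
    rw [← div_eq_inv_mul, le_div_iff₀' hpos]
    have h := integral_abs_sub_le_of_factorization (μ := μ) (ν := ν) (s := ι ⁻¹' {i})
      (a := bA m i) (b := bB m i) (u := uA m) (v := uB m) (k := fun z => Real.exp (-c z / ε))
      (hι i) hκ hk1 (fun x => ((hA m).u_mem x).1) ((hA m).integrable_b i) ((hB m).integrable_b i)
      (fun y => ((hB m).b_mem i y).1) ((hA m).integral_b i) ((hB m).integral_b i)
      (hA m).measurable (hB m).measurable (hA m).mem (hB m).mem
      (fun x hx y => by rw [(hA m).eq]; simp only; rw [show ι x = i from hx])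
      (fun x hx y => by rw [(hB m).eq]; simp only; rw [show ι x = i from hx])
    refine le_trans ?_ h
    rw [mul_assoc]
    exact mul_le_mul_of_nonneg_right (hm i)
      (mul_nonneg (by positivity) (integral_nonneg fun y => abs_nonneg _))
  have i₀ : I := Classical.arbitrary I
  have hsum : Tendsto (fun m => 2 * (κ⁻¹ * κ⁻¹ * ∑ i, ∫ y, |bA m i y - bA m i₀ y| ∂ν)) atTop
      (𝓝 0) := by
    have h : Tendsto (fun m => ∑ i, ∫ y, |bA m i y - bA m i₀ y| ∂ν) atTop (𝓝 (∑ i : I, 0)) :=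
      tendsto_finsetSum _ fun i _ => tendsto_integral_abs_sub_of_reflTransGen
        (fun m => (hA m).integrable_b) (fun m => (hB m).integrable_b) hr hs hb (hrs i₀ i)
    simpa using (h.const_mul (κ⁻¹ * κ⁻¹)).const_mul 2
  have hB0 : (0 : ℝ) < max (κ⁻¹ ^ 4) (κ⁻¹ * (κ ^ 2 * m₀)⁻¹ * κ⁻¹) :=
    lt_max_of_lt_left (by positivity)
  have hqB : ∀ m z, p (3 * m) z ≤ max (κ⁻¹ ^ 4) (κ⁻¹ * (κ ^ 2 * m₀)⁻¹ * κ⁻¹) := fun m z =>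
    ((hA m).mem z).2.trans (le_max_right _ _)
  choose R₀ A h1 h2 h3 h4 using fun m => exists_scaling_close hc hcM hε hκ hk1 hk2
    (le_max_left _ _) (hA m).eq (hA m).measurable_u (hA m).measurable_b (hA m).u_mem
    (hA m).b_mem (hp (3 * m)) (hqB m) i₀
  exact exists_limit_of_almost_scaling hc hcM hε hB0 hn hp hmono hqB h1 h2 h3
    (squeeze_zero (fun m => integral_nonneg fun z => abs_nonneg _) h4 hsum)

end Alternating

/-- convergence of the hybrid scheme. The iterates, alternating two domain
decomposition half-iterations (on `𝒥_A` and `𝒥_B`) and a flow update with gluing edge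
candidates, converge weak* to the unique minimizer of the entropic OT problem. -/
theorem hybrid_scheme_converges
    {X Y : Type*} [MetricSpace X] [CompactSpace X] [MeasurableSpace X] [BorelSpace X]
    [MetricSpace Y] [CompactSpace Y] [MeasurableSpace Y] [BorelSpace Y]
    {I : Type*} [Fintype I] [DecidableEq I]
    (μ : Measure X) (ν : Measure Y) [IsProbabilityMeasure μ] [IsProbabilityMeasure ν]
    (c : X × Y → ℝ) (hc : Continuous c) (ε : ℝ) (hε : 0 < ε)
    -- basic partition into closed cells with strictly positive masses
    (Xpart : I → Set X) (hclosed : ∀ i, IsClosed (Xpart i))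
    (hcover : ⋃ i, Xpart i = Set.univ)
    (hdisj : ∀ i j, i ≠ j → μ (Xpart i ∩ Xpart j) = 0)
    (hm : ∀ i, 0 < μ (Xpart i))
    -- composite partitions 𝒥_A and 𝒥_B of the index set I
    (JA JB : Finset (Finset I))
    (hJA : ∀ i : I, ∃! J : Finset I, J ∈ JA ∧ i ∈ J)
    (hJB : ∀ i : I, ∃! J : Finset I, J ∈ JB ∧ i ∈ J)
    -- connected partition graph
    (hconn : ∀ J ∈ JA ∪ JB, ∀ J' ∈ JA ∪ JB,
      Relation.ReflTransGen
        (fun K K' : Finset I => K ∈ JA ∪ JB ∧ K' ∈ JA ∪ JB ∧ (K ∩ K').Nonempty) J J')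
    -- the sequence of iterates of the hybrid scheme (feasible couplings)
    (πseq : ℕ → Measure (X × Y))
    (hfeasible : ∀ k, IsCoupling μ ν (πseq k))
    -- π^{3ℓ+1} = S_A(π^{3ℓ})
    (hA : ∀ ℓ : ℕ,
      πseq (3 * ℓ + 1)
        = (∑ J ∈ JA, (πseq (3 * ℓ + 1)).restrict ((⋃ i ∈ J, Xpart i) ×ˢ Set.univ)) ∧
      ∀ J ∈ JA, CellSolve c ε ν (πseq (3 * ℓ)) (πseq (3 * ℓ + 1)) (⋃ i ∈ J, Xpart i))
    -- π^{3ℓ+2} = S_B(π^{3ℓ+1})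
    (hB : ∀ ℓ : ℕ,
      πseq (3 * ℓ + 2)
        = (∑ J ∈ JB, (πseq (3 * ℓ + 2)).restrict ((⋃ i ∈ J, Xpart i) ×ˢ Set.univ)) ∧
      ∀ J ∈ JB, CellSolve c ε ν (πseq (3 * ℓ + 1)) (πseq (3 * ℓ + 2)) (⋃ i ∈ J, Xpart i))
    -- π^{3ℓ+3} is a flow update of π^{3ℓ+2} with gluing edge candidates; in particular it is
    -- a feasible coupling and does not increase the entropic objective
    (hF : ∀ ℓ : ℕ,
      IsGluingFlowUpdate μ c Xpart (πseq (3 * ℓ + 2)) (πseq (3 * ℓ + 3)) ∧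
      IsCoupling μ ν (πseq (3 * ℓ + 3)) ∧
      EOT c ε μ ν (πseq (3 * ℓ + 3)) ≤ EOT c ε μ ν (πseq (3 * ℓ + 2))) :
    ∃ πopt : Measure (X × Y), IsCoupling μ ν πopt ∧
      (∀ σ : Measure (X × Y), IsCoupling μ ν σ → EOT c ε μ ν πopt ≤ EOT c ε μ ν σ) ∧
      ∀ f : X × Y → ℝ, Continuous f →
        Tendsto (fun k => ∫ p, f p ∂(πseq k)) atTop (𝓝 (∫ p, f p ∂πopt)) := by
  have hX : Nonempty X := by
    by_contra h
    rw [not_nonempty_iff] at h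
    exact IsProbabilityMeasure.ne_zero μ (Measure.eq_zero_of_isEmpty μ)
  have hY : Nonempty Y := by
    by_contra h
    rw [not_nonempty_iff] at h
    exact IsProbabilityMeasure.ne_zero ν (Measure.eq_zero_of_isEmpty ν)
  have hbdd : ∀ f : X × Y → ℝ, Continuous f → ∃ M, ∀ z, |f z| ≤ M := by
    intro f hf
    obtain ⟨M, hM⟩ := isCompact_univ.exists_bound_of_continuousOn hf.continuousOn
    exact ⟨M, fun z => hM z (Set.mem_univ z)⟩
  have hcm : Measurable c := hc.measurable
  obtain ⟨M, hcM⟩ := hbdd c hc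
  have hM0 : 0 ≤ M := (abs_nonneg _).trans (hcM (Classical.arbitrary (X × Y)))
  obtain ⟨κ, hκ⟩ : ∃ κ, κ = Real.exp (-M / ε) := ⟨_, rfl⟩
  have hκ0 : 0 < κ := hκ ▸ Real.exp_pos _
  have hκ1 : κ ≤ 1 := by
    rw [hκ, Real.exp_le_one_iff, neg_div]
    exact neg_nonpos.2 (div_nonneg hM0 hε.le)
  have hk1 : ∀ z, κ ≤ Real.exp (-c z / ε) := fun z => by
    rw [hκ, Real.exp_le_exp]
    exact div_le_div_of_nonneg_right (neg_le_neg (le_of_abs_le (hcM z))) hε.le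
  have hk2 : ∀ z, Real.exp (-c z / ε) ≤ κ⁻¹ := fun z => by
    rw [hκ, ← Real.exp_neg, Real.exp_le_exp, neg_div, neg_div, neg_neg, ← neg_div]
    exact div_le_div_of_nonneg_right (neg_le.1 (neg_le_of_abs_le (hcM z))) hε.le
  obtain ⟨ι, hι, hae⟩ := exists_label (fun i => (hclosed i).measurableSet) hcover hdisj
  have : Nonempty I := ⟨ι (Classical.arbitrary X)⟩
  obtain ⟨i₁, -, hi₁⟩ := Finset.exists_min_image Finset.univ (fun i => μ.real (Xpart i))
    Finset.univ_nonempty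
  have hm₀ : 0 < μ.real (Xpart i₁) := ENNReal.toReal_pos (hm i₁).ne' (measure_ne_top _ _)
  have hm' : ∀ i, μ.real (Xpart i₁) ≤ μ.real (Xpart i) := fun i => hi₁ i (Finset.mem_univ i)
  generalize μ.real (Xpart i₁) = m₀ at hm₀ hm'
  choose CA hCA hCA' using hJA
  choose CB hCB hCB' using hJB
  have hA' : ∀ J ∈ JA, ∀ i, CA i = J ↔ i ∈ J := fun J hJ i =>
    ⟨fun h => h ▸ (hCA i).2, fun h => (hCA' i J ⟨hJ, h⟩).symm⟩
  have hB' : ∀ J ∈ JB, ∀ i, CB i = J ↔ i ∈ J := fun J hJ i =>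
    ⟨fun h => h ▸ (hCB i).2, fun h => (hCB' i J ⟨hJ, h⟩).symm⟩
  choose uA bA qA hsA hrA using fun m => exists_isStepDensity hcm hcM hε hκ0 hκ1 hk1 hk2
    (hfeasible (3 * m)) (hfeasible (3 * m + 1)) hι hae hm₀ hm' (fun i => (hCA i).1) hA' (hA m).2
  choose uB bB qB hsB hrB using fun m => exists_isStepDensity hcm hcM hε hκ0 hκ1 hk1 hk2
    (hfeasible (3 * m + 1)) (hfeasible (3 * m + 2)) hι hae hm₀ hm' (fun i => (hCB i).1) hB'
    (hB m).2
  have hqA := fun m => (hsA m).isCouplingDens (hfeasible (3 * m + 1))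
  have hqB := fun m => (hsB m).isCouplingDens (hfeasible (3 * m + 2))
  have hEOT : ∀ {s}, IsCouplingDens μ ν s →
      EOT c ε μ ν (dens (μ.prod ν) s) = (energy c ε (μ.prod ν) s : ℝ) := fun h =>
    EOT_dens h.measurable h.nonneg h.integrable_phiKL
  have hdens : ∀ {σ : Measure (X × Y)}, IsCoupling μ ν σ → EOT c ε μ ν σ ≠ ⊤ →
      ∃ s, IsCouplingDens μ ν s ∧ σ = dens (μ.prod ν) s := by
    intro σ hσ h
    have := hσ.isFiniteMeasure
    obtain ⟨s, h1, h2, -, h3, h4⟩ := exists_dens_of_EOT_ne_top hε h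
    exact ⟨s, ⟨h1, h2, h3, h4 ▸ hσ⟩, h4⟩
  have hex : ∀ k, ∃ p, IsCouplingDens μ ν p ∧ πseq (k + 1) = dens (μ.prod ν) p ∧
      (∀ m, k = 3 * m → p = qA m) ∧ (∀ m, k = 3 * m + 1 → p = qB m) := by
    intro k
    obtain ⟨m, h | h | h⟩ : ∃ m, k = 3 * m ∨ k = 3 * m + 1 ∨ k = 3 * m + 2 := ⟨k / 3, by omega⟩
    · subst h
      refine ⟨qA m, hqA m, (hsA m).dens_eq, fun n hn => ?_, fun n hn => by omega⟩
      rw [show m = n by omega]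
    · subst h
      refine ⟨qB m, hqB m, (hsB m).dens_eq, fun n hn => by omega, fun n hn => ?_⟩
      rw [show m = n by omega]
    · subst h
      obtain ⟨s, h1, h2⟩ := hdens (hF m).2.1 (ne_top_of_le_ne_top (by
        rw [(hsB m).dens_eq, hEOT (hqB m)]
        exact EReal.coe_ne_top _) (hF m).2.2)
      exact ⟨s, h1, h2, fun n hn => by omega, fun n hn => by omega⟩
  choose p hp hπ hpA hpB using hex
  obtain ⟨g, hg, hmin, hlim⟩ := exists_limit_of_alternating hcm hcM hε hκ0 hk1 hk2 hι hm₀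
    (fun i => (hm' i).trans (measureReal_congr (hae i)).ge) (π := πseq) (p := p)
    (fun m => by rw [hpA _ m rfl]; exact hsA m) (fun m => by rw [hpB _ m rfl]; exact hsB m)
    hp hπ (fun m => by
      have h := (hF m).2.2
      rw [hπ (3 * m + 2), hπ (3 * m + 1), hEOT (hp _), hEOT (hp _)] at h
      exact EReal.coe_le_coe_iff.1 h)
    (r := fun i j => CA i = CA j) (s := fun i j => CB i = CB j) hrA hrB
    (reflTransGen_of_connected (fun i => (hCA i).1) hA' hB' hconn)
  refine ⟨dens (μ.prod ν) g, hg.isCoupling, fun σ hσ => ?_, fun f hf => ?_⟩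
  · by_cases h : EOT c ε μ ν σ = ⊤
    · exact h ▸ le_top
    · obtain ⟨s, hs, rfl⟩ := hdens hσ h
      rw [hEOT hg, hEOT hs]
      exact EReal.coe_le_coe_iff.2 (hmin s hs)
  · obtain ⟨C, hC⟩ := hbdd f hf
    rw [← tendsto_add_atTop_iff_nat 1]
    simp_rw [hπ, integral_dens (hp _).measurable (hp _).nonneg,
      integral_dens hg.measurable hg.nonneg]
    exact tendsto_integral_mul_of_tendsto_integral_abs_sub (fun k => (hp k).integrable)
      hg.integrable hf.measurable hC hlim
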